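/- Let A be a primitive set and let q be a prime with q ∉ A. Let A'_q = {a ∈ A : the least prime factor of a equals q}. Then f(A'_q) < e^γ · g(q), where g(q) = (1/q)·∏_{p prime, p<q}(1 − 1/p) and f(S) = ∑_{a∈S} 1/(a·log a). -/

import Mathlib

open scoped BigOperators

/-- A set of positive integers is *primitive* if every element exceeds 1 and
no element divides another element. -/
def IsPrimitive (A : Set ℕ) : Prop :=
  (∀ a ∈ A, 1 < a) ∧ ∀ a ∈ A, ∀ b ∈ A, a ≠ b → ¬ a ∣ b

/-- `f A = ∑_{a ∈ A} 1/(a log a)`. -/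
noncomputable def f (A : Set ℕ) : ℝ :=
  ∑' a : A, 1 / ((a : ℕ) * Real.log (a : ℕ))

/-- `g q = (1/q) ∏_{p prime, p < q} (1 - 1/p)`. -/
noncomputable def g (q : ℕ) : ℝ :=
  (1 / q) * ∏ p ∈ q.primesBelow, (1 - 1 / (p : ℝ))

open Finset ArithmeticFunction in
/-- Expected reward collected from `m` on by the upward divisor chain. -/
noncomputable def chainWeight (h : ℕ → ℝ) (B : Finset ℕ) (N m : ℕ) : ℝ :=
  (if m ∈ B then h m else 0) +
    ∑ n ∈ (Finset.Ioc m N).attach,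
      if m ∣ n.1 then chainWeight h B N n.1 * (vonMangoldt (n.1 / m) / Real.log n.1) else 0
termination_by N - m
decreasing_by
  have := Finset.mem_Ioc.1 n.2
  omega

section Chain

open Finset ArithmeticFunction

variable {h : ℕ → ℝ} {B : Finset ℕ} {N : ℕ}

theorem chainWeight_eq (m : ℕ) : chainWeight h B N m = (if m ∈ B then h m else 0) +
    ∑ n ∈ (Ioc m N).filter (m ∣ ·),
      chainWeight h B N n * (vonMangoldt (n / m) / Real.log n) := by
  rw [chainWeight, sum_filter, ← sum_attach (Ioc m N)]

theorem chainWeight_eq_zero {m : ℕ} (hm : ∀ b ∈ B, ¬ m ∣ b) : chainWeight h B N m = 0 := by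
  induction hk : N - m using Nat.strong_induction_on generalizing m with
  | _ k ih =>
    rw [chainWeight_eq, if_neg (fun hb => hm m hb dvd_rfl), zero_add]
    refine sum_eq_zero fun n hn => ?_
    rw [mem_filter, mem_Ioc] at hn
    rw [ih (N - n) (by omega) (fun b hb hnb => hm b hb (hn.2.trans hnb)) rfl, zero_mul]

theorem chainWeight_le (hB : ∀ a ∈ B, ∀ b ∈ B, a ≠ b → ¬ a ∣ b) {P : ℕ → Prop}
    (hP : ∀ m d, d ∣ m → P m → P d) (hBP : ∀ b ∈ B, 1 < b ∧ P b) (h0 : ∀ m, 0 ≤ h m)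
    (hsub : ∀ m, 1 < m → P m → ∀ F : Finset ℕ, (∀ d ∈ F, 1 < d ∧ P d) →
      ∑ d ∈ F, h (m * d) * (vonMangoldt d / Real.log (m * d : ℕ)) ≤ h m)
    {m : ℕ} (hm : 1 < m) : chainWeight h B N m ≤ h m := by
  induction hk : N - m using Nat.strong_induction_on generalizing m with
  | _ k ih =>
    by_cases hmB : m ∈ B
    · rw [chainWeight_eq, if_pos hmB, sum_eq_zero, add_zero]
      intro n hn
      rw [mem_filter, mem_Ioc] at hn
      rw [chainWeight_eq_zero, zero_mul]
      intro b hb hnb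
      have hbpos : 0 < b := by have := (hBP b hb).1; omega
      have := Nat.le_of_dvd hbpos hnb
      exact hB m hmB b hb (by omega) (hn.2.trans hnb)
    · by_cases hmP : P m
      swap
      · rw [chainWeight_eq_zero]
        · exact h0 m
        · exact fun b hb hmb => hmP (hP b m hmb (hBP b hb).2)
      rw [chainWeight_eq, if_neg hmB, zero_add]
      have hm0 : 0 < m := by omega
      classical
      calc ∑ n ∈ (Ioc m N).filter (m ∣ ·), chainWeight h B N n * (vonMangoldt (n / m) / Real.log n)
          = ∑ n ∈ ((Ioc m N).filter (m ∣ ·)).filter P,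
              chainWeight h B N n * (vonMangoldt (n / m) / Real.log n) := by
            refine (sum_filter_of_ne fun n hn hne => ?_).symm
            by_contra hPn
            exact hne (by
              rw [chainWeight_eq_zero, zero_mul]
              exact fun b hb hnb => hPn (hP b n hnb (hBP b hb).2))
        _ ≤ ∑ n ∈ ((Ioc m N).filter (m ∣ ·)).filter P,
              h n * (vonMangoldt (n / m) / Real.log n) := by
            refine sum_le_sum fun n hn => ?_
            rw [mem_filter, mem_filter, mem_Ioc] at hn
            refine mul_le_mul_of_nonneg_right (ih (N - n) (by omega) (by omega) rfl) ?_
            exact div_nonneg vonMangoldt_nonneg (Real.log_natCast_nonneg _)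
        _ = ∑ d ∈ (((Ioc m N).filter (m ∣ ·)).filter P).image (· / m),
              h (m * d) * (vonMangoldt d / Real.log (m * d : ℕ)) := by
            rw [sum_image]
            · refine sum_congr rfl fun n hn => ?_
              rw [mem_filter, mem_filter] at hn
              rw [Nat.mul_div_cancel' hn.1.2]
            · intro a ha b hb hab
              simp only [coe_filter, mem_filter, Set.mem_ofPred_eq] at ha hb
              rw [← Nat.mul_div_cancel' ha.1.2, ← Nat.mul_div_cancel' hb.1.2]
              exact congrArg _ hab
        _ ≤ h m := by
            refine hsub m hm hmP _ fun d hd => ?_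
            rw [mem_image] at hd
            obtain ⟨n, hn, rfl⟩ := hd
            rw [mem_filter, mem_filter, mem_Ioc] at hn
            obtain ⟨⟨⟨h1, -⟩, c, rfl⟩, h3⟩ := hn
            rw [Nat.mul_div_cancel_left _ hm0]
            exact ⟨by nlinarith, hP _ _ (dvd_mul_left _ _) h3⟩

theorem sum_eq_sum_chainWeight (hB1 : ∀ b ∈ B, 1 < b ∧ b ≤ N) :
    ∑ b ∈ B, h b = ∑ n ∈ Icc 2 N, chainWeight h B N n * (vonMangoldt n / Real.log n) := by
  have key : ∀ n ∈ Icc 2 N, chainWeight h B N n =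
      chainWeight h B N n * (vonMangoldt n / Real.log n) +
      ∑ m ∈ Icc 2 N, if m ∣ n ∧ m < n then
        chainWeight h B N n * (vonMangoldt (n / m) / Real.log n) else 0 := by
    intro n hn
    rw [mem_Icc] at hn
    have hlog : Real.log n ≠ 0 := (Real.log_pos (by exact_mod_cast hn.1)).ne'
    have hsum : Real.log n = vonMangoldt n +
        ∑ m ∈ (Icc 2 N).filter (fun m => m ∣ n ∧ m < n), vonMangoldt (n / m) := by
      rw [← vonMangoldt_sum, ← Nat.sum_div_divisors n (fun d => vonMangoldt d)]
      have hdiv : n.divisors = insert 1 (insert n ((Icc 2 N).filter (fun m => m ∣ n ∧ m < n))) := by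
        ext m
        simp only [Nat.mem_divisors, mem_insert, mem_filter, mem_Icc]
        constructor
        · rintro ⟨h1, h2⟩
          have := Nat.le_of_dvd (by omega) h1
          have : 0 < m := Nat.pos_of_dvd_of_pos h1 (by omega)
          by_cases hm1 : m = 1
          · exact Or.inl hm1
          by_cases hmn : m = n
          · exact Or.inr (Or.inl hmn)
          · exact Or.inr (Or.inr ⟨⟨by omega, by omega⟩, h1, by omega⟩)
        · rintro (rfl | rfl | ⟨-, h1, -⟩)
          · exact ⟨one_dvd _, by omega⟩
          · exact ⟨dvd_rfl, by omega⟩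
          · exact ⟨h1, by omega⟩
      rw [hdiv, sum_insert, sum_insert, Nat.div_one, Nat.div_self (by omega), vonMangoldt_apply_one,
        zero_add]
      · simp
      · simp only [mem_insert, mem_filter, mem_Icc]; omega
    rw [← sum_filter, ← mul_sum, ← mul_add, ← sum_div, ← add_div, ← hsum, div_self hlog, mul_one]
  have key2 : ∀ m ∈ Icc 2 N, (∑ n ∈ Icc 2 N, if m ∣ n ∧ m < n then
        chainWeight h B N n * (vonMangoldt (n / m) / Real.log n) else 0) =
      chainWeight h B N m - if m ∈ B then h m else 0 := by
    intro m hm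
    rw [chainWeight_eq, add_sub_cancel_left, ← sum_filter]
    refine sum_congr ?_ fun _ _ => rfl
    ext n
    simp only [mem_filter, mem_Icc, mem_Ioc] at hm ⊢
    constructor <;> intro hh
    · exact ⟨⟨by omega, by omega⟩, hh.2.1⟩
    · exact ⟨⟨by omega, by omega⟩, hh.2, by omega⟩
  have h1 := sum_congr rfl key
  rw [sum_add_distrib, sum_comm, sum_congr rfl key2, sum_sub_distrib] at h1
  have h2 : (∑ m ∈ Icc 2 N, if m ∈ B then h m else 0) = ∑ b ∈ B, h b := by
    rw [← sum_filter]
    refine sum_congr ?_ fun _ _ => rfl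
    ext b
    simp only [mem_filter, mem_Icc]
    exact ⟨fun hb => hb.2, fun hb => ⟨by have := hB1 b hb; omega, hb⟩⟩
  linarith

/-- A weighted LYM inequality: a finite antichain for divisibility has `h`-mass at most the initial
mass of a chain for which `h` is subinvariant. -/
theorem sum_antichain_le (hB : ∀ a ∈ B, ∀ b ∈ B, a ≠ b → ¬ a ∣ b) {P : ℕ → Prop}
    (hP : ∀ m d, d ∣ m → P m → P d) (hBP : ∀ b ∈ B, 1 < b ∧ P b) (h0 : ∀ m, 0 ≤ h m)
    (hsub : ∀ m, 1 < m → P m → ∀ F : Finset ℕ, (∀ d ∈ F, 1 < d ∧ P d) →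
      ∑ d ∈ F, h (m * d) * (vonMangoldt d / Real.log (m * d : ℕ)) ≤ h m)
    {I : ℝ} (hI : ∀ F : Finset ℕ, (∀ d ∈ F, 1 < d ∧ P d) →
      ∑ d ∈ F, h d * (vonMangoldt d / Real.log d) ≤ I) :
    ∑ b ∈ B, h b ≤ I := by
  classical
  rw [sum_eq_sum_chainWeight (N := B.sup id) (fun b hb => ⟨(hBP b hb).1, le_sup (f := id) hb⟩)]
  rw [← sum_filter_of_ne (p := P)]
  · refine le_trans (sum_le_sum fun n hn => ?_) (hI ((Icc 2 (B.sup id)).filter P) ?_)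
    · rw [mem_filter, mem_Icc] at hn
      refine mul_le_mul_of_nonneg_right
        (chainWeight_le hB hP hBP h0 hsub (by omega)) ?_
      exact div_nonneg vonMangoldt_nonneg (Real.log_natCast_nonneg _)
    · intro d hd
      rw [mem_filter, mem_Icc] at hd
      exact ⟨by omega, hd.2⟩
  · intro n hn hne
    by_contra hPn
    exact hne (by
      rw [chainWeight_eq_zero, zero_mul]
      exact fun b hb hnb => hPn (hP b n hnb (hBP b hb).2))

end Chain

section MangoldtSeries

open ArithmeticFunction

theorem summable_log_mul_rpow {t : ℝ} (ht : 0 < t) :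
    Summable fun n : ℕ => Real.log n * (n : ℝ) ^ (-(1 + t)) := by
  have hs : Summable fun n : ℕ => (2 / t) * (n : ℝ) ^ (-(1 + t / 2)) :=
    (Real.summable_nat_rpow.2 (by linarith)).mul_left _
  refine hs.of_nonneg_of_le (fun n => mul_nonneg (Real.log_natCast_nonneg _) (by positivity)) ?_
  intro n
  rcases Nat.eq_zero_or_pos n with rfl | hn
  · rw [Nat.cast_zero, Real.log_zero, zero_mul]; positivity
  have hn' : (0 : ℝ) < n := by exact_mod_cast hn
  have h1 := Real.log_natCast_le_rpow_div n (half_pos ht)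
  calc Real.log n * (n : ℝ) ^ (-(1 + t)) ≤ (n : ℝ) ^ (t / 2) / (t / 2) * (n : ℝ) ^ (-(1 + t)) := by
        gcongr
    _ = (2 / t) * ((n : ℝ) ^ (t / 2) * (n : ℝ) ^ (-(1 + t))) := by field_simp
    _ = _ := by rw [← Real.rpow_add hn']; ring_nf

theorem log_mul_rpow_pair {t : ℝ} (ht : 0 < t) :
    Real.log 3 * (3 : ℝ) ^ (-(1 + t)) + Real.log 5 * (5 : ℝ) ^ (-(1 + t)) ≤
      Real.log 2 * (2 : ℝ) ^ (-(1 + t)) + Real.log 4 * (4 : ℝ) ^ (-(1 + t)) := by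
  have hsplit : ∀ x : ℝ, 0 < x → x ^ (-(1 + t)) = x⁻¹ * x ^ (-t) := fun x hx => by
    rw [neg_add, Real.rpow_add hx, Real.rpow_neg_one]
  rw [hsplit 2 (by norm_num), hsplit 3 (by norm_num), hsplit 4 (by norm_num),
    hsplit 5 (by norm_num)]
  have h4 : Real.log 4 = 2 * Real.log 2 := by
    rw [show (4 : ℝ) = 2 ^ 2 by norm_num, Real.log_pow]; norm_num
  have h42 : (4 : ℝ) ^ (-t) = (2 : ℝ) ^ (-t) * (2 : ℝ) ^ (-t) := by
    rw [← Real.mul_rpow (by norm_num) (by norm_num)]; norm_num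
  have ha : 0 < (2 : ℝ) ^ (-t) := by positivity
  have ha1 : (2 : ℝ) ^ (-t) ≤ 1 := Real.rpow_le_one_of_one_le_of_nonpos (by norm_num) (by linarith)
  have h54 : (5 : ℝ) ^ (-t) ≤ (4 : ℝ) ^ (-t) :=
    Real.rpow_le_rpow_of_nonpos (by norm_num) (by norm_num) (by linarith)
  have h3 : (3 : ℝ) ^ (-t) * (3 : ℝ) ^ (-t) ≤ (2 : ℝ) ^ (-t) * (4 : ℝ) ^ (-t) := by
    rw [← Real.mul_rpow (by norm_num) (by norm_num), ← Real.mul_rpow (by norm_num) (by norm_num)]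
    exact Real.rpow_le_rpow_of_nonpos (by norm_num) (by norm_num) (by linarith)
  have h3' : 0 < (3 : ℝ) ^ (-t) := by positivity
  have h3'' : (3 : ℝ) ^ (-t) ≤ ((2 : ℝ) ^ (-t) + (4 : ℝ) ^ (-t)) / 2 := by
    nlinarith [sq_nonneg ((2 : ℝ) ^ (-t) - (4 : ℝ) ^ (-t)),
      Real.rpow_pos_of_pos (show (0 : ℝ) < 4 by norm_num) (-t)]
  have hlog : 5 * Real.log 3 + 3 * Real.log 5 ≤ 15 * Real.log 2 := by
    have : Real.log (3 ^ 5 * 5 ^ 3) ≤ Real.log (2 ^ 15) :=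
      Real.log_le_log (by norm_num) (by norm_num)
    rw [Real.log_mul (by norm_num) (by norm_num), Real.log_pow, Real.log_pow, Real.log_pow] at this
    norm_num at this
    linarith
  have l3 : 0 < Real.log 3 := Real.log_pos (by norm_num)
  have l5 : 0 < Real.log 5 := Real.log_pos (by norm_num)
  have hx : (4 : ℝ) ^ (-t) ≤ (2 : ℝ) ^ (-t) := by rw [h42]; nlinarith
  have h5'' : (5 : ℝ) ^ (-t) ≤ ((2 : ℝ) ^ (-t) + (4 : ℝ) ^ (-t)) / 2 := by linarith
  rw [h4]
  have e3 := mul_le_mul_of_nonneg_left h3'' l3.le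
  have e5 := mul_le_mul_of_nonneg_left h5'' l5.le
  have hp : 0 < (2 : ℝ) ^ (-t) + (4 : ℝ) ^ (-t) := by positivity
  have e := mul_le_mul_of_nonneg_right hlog hp.le
  linarith

theorem log_mul_rpow_antitone {t : ℝ} (ht : 0 < t) {m : ℕ} (hm : 3 ≤ m) :
    Real.log (m + 1 : ℕ) * ((m + 1 : ℕ) : ℝ) ^ (-(1 + t)) ≤ Real.log m * (m : ℝ) ^ (-(1 + t)) := by
  have hm' : (3 : ℝ) ≤ m := by exact_mod_cast hm
  have hsplit : ∀ x : ℝ, 0 < x → Real.log x * x ^ (-(1 + t)) = Real.log x / x * x ^ (-t) :=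
    fun x hx => by rw [neg_add, Real.rpow_add hx, Real.rpow_neg_one]; ring
  rw [hsplit _ (by positivity), hsplit _ (by positivity)]
  have he : Real.exp 1 ≤ 3 := by linarith [Real.exp_one_lt_d9]
  have h1 : Real.log (m + 1 : ℕ) / ((m + 1 : ℕ) : ℝ) ≤ Real.log m / m :=
    Real.log_div_self_antitoneOn (by simpa using he.trans hm')
      (by change Real.exp 1 ≤ ((m + 1 : ℕ) : ℝ); push_cast; linarith) (by push_cast; linarith)
  have h2 : ((m + 1 : ℕ) : ℝ) ^ (-t) ≤ (m : ℝ) ^ (-t) :=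
    Real.rpow_le_rpow_of_nonpos (by positivity) (by push_cast; linarith) (by linarith)
  have : 0 ≤ Real.log m / m := div_nonneg (Real.log_natCast_nonneg _) (by positivity)
  exact mul_le_mul h1 h2 (by positivity) this

theorem tsum_log_mul_rpow_le {t : ℝ} (ht : 0 < t) :
    (∑' n : ℕ, Real.log n * (n : ℝ) ^ (-(1 + t))) * ((2 : ℝ) ^ t - 1) ≤
      Real.log 2 * ∑' n : ℕ, (n : ℝ) ^ (-(1 + t)) := by
  set H : ℕ → ℝ := fun n => Real.log n * (n : ℝ) ^ (-(1 + t)) with hH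
  have hs : Summable H := summable_log_mul_rpow ht
  have hz : Summable fun n : ℕ => (n : ℝ) ^ (-(1 + t)) := Real.summable_nat_rpow.2 (by linarith)
  have he : Summable fun n => H (2 * n) := hs.comp_injective (mul_right_injective₀ two_ne_zero)
  have ho : Summable fun n => H (2 * n + 1) :=
    hs.comp_injective ((add_left_injective 1).comp (mul_right_injective₀ (two_ne_zero' ℕ)))
  have heo := tsum_even_add_odd he ho
  have heven : ∑' n, H (2 * n) = (2 : ℝ) ^ (-(1 + t)) *
      (Real.log 2 * (∑' n : ℕ, (n : ℝ) ^ (-(1 + t))) + ∑' n, H n) := by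
    rw [← tsum_mul_left, ← (hz.mul_left _).tsum_add hs, ← tsum_mul_left]
    refine tsum_congr fun n => ?_
    rcases Nat.eq_zero_or_pos n with rfl | hn
    · simp only [hH, mul_zero, Nat.cast_zero, Real.log_zero,
        Real.zero_rpow (show -(1 + t) ≠ 0 by linarith), add_zero]
    have hn' : (n : ℝ) ≠ 0 := by positivity
    simp only [hH]
    push_cast
    rw [Real.log_mul two_ne_zero hn', Real.mul_rpow two_pos.le n.cast_nonneg]
    ring
  have hodd : ∑' n, H (2 * n + 1) ≤ ∑' n, H (2 * n) := by
    rw [← ho.sum_add_tsum_nat_add 3, ← he.sum_add_tsum_nat_add 3]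
    refine add_le_add ?_ (Summable.tsum_le_tsum (fun n => ?_) ((summable_nat_add_iff 3).2 ho)
      ((summable_nat_add_iff 3).2 he))
    · have := log_mul_rpow_pair ht
      simp only [Finset.sum_range_succ, Finset.sum_range_zero, hH]
      norm_num [-neg_add_rev] at this ⊢
      exact this
    · exact log_mul_rpow_antitone ht (by omega)
  have h2 : (2 : ℝ) ^ (-(1 + t)) * 2 * (2 : ℝ) ^ t = 1 := by
    rw [mul_right_comm, ← Real.rpow_add two_pos, show -(1 + t) + t = -1 by ring,
      Real.rpow_neg_one]; norm_num
  have h3 : ∑' n, H n ≤ (2 * (2 : ℝ) ^ (-(1 + t))) *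
      (Real.log 2 * (∑' n : ℕ, (n : ℝ) ^ (-(1 + t))) + ∑' n, H n) := by
    rw [mul_assoc, ← heven, ← heo]; linarith
  have h4 := mul_le_mul_of_nonneg_right h3 (Real.rpow_pos_of_pos two_pos t).le
  have h5 : (2 * (2 : ℝ) ^ (-(1 + t))) *
      (Real.log 2 * (∑' n : ℕ, (n : ℝ) ^ (-(1 + t))) + ∑' n, H n) * (2 : ℝ) ^ t =
      Real.log 2 * (∑' n : ℕ, (n : ℝ) ^ (-(1 + t))) + ∑' n, H n := by
    linear_combination (Real.log 2 * (∑' n : ℕ, (n : ℝ) ^ (-(1 + t))) + ∑' n, H n) * h2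
  rw [h5] at h4
  linarith

/-- `∑ Λ(d) d⁻¹⁻ᵗ ≤ log 2 / (2ᵗ - 1)`. -/
theorem sum_vonMangoldt_mul_rpow_le {t : ℝ} (ht : 0 < t) (F : Finset ℕ) :
    ∑ d ∈ F, vonMangoldt d * (d : ℝ) ^ (-(1 + t)) ≤ Real.log 2 / ((2 : ℝ) ^ t - 1) := by
  have h2t : 1 < (2 : ℝ) ^ t := Real.one_lt_rpow (by norm_num) ht
  have hs := summable_log_mul_rpow ht
  have hz : Summable fun n : ℕ => (n : ℝ) ^ (-(1 + t)) := Real.summable_nat_rpow.2 (by linarith)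
  have hzpos : 0 < ∑' n : ℕ, (n : ℝ) ^ (-(1 + t)) :=
    hz.tsum_pos (fun n => by positivity) 1 (by simp)
  have key : (∑ d ∈ F, vonMangoldt d * (d : ℝ) ^ (-(1 + t))) * ∑' n : ℕ, (n : ℝ) ^ (-(1 + t)) ≤
      ∑' n : ℕ, Real.log n * (n : ℝ) ^ (-(1 + t)) := by
    have hsd : ∀ d : ℕ, Summable fun n : ℕ =>
        if d ∣ n then vonMangoldt d * (n : ℝ) ^ (-(1 + t)) else 0 := fun d =>
      ((hz.mul_left (vonMangoldt d)).indicator {n | d ∣ n}).congr fun n => by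
        simp [Set.indicator_apply]
    calc (∑ d ∈ F, vonMangoldt d * (d : ℝ) ^ (-(1 + t))) * ∑' n : ℕ, (n : ℝ) ^ (-(1 + t))
        = ∑ d ∈ F, ∑' n : ℕ, vonMangoldt d * ((d * n : ℕ) : ℝ) ^ (-(1 + t)) := by
          rw [Finset.sum_mul]
          refine Finset.sum_congr rfl fun d _ => ?_
          rw [← tsum_mul_left]
          refine tsum_congr fun n => ?_
          rw [Nat.cast_mul, Real.mul_rpow d.cast_nonneg n.cast_nonneg, mul_assoc]
      _ ≤ ∑ d ∈ F, ∑' n : ℕ, if d ∣ n then vonMangoldt d * (n : ℝ) ^ (-(1 + t)) else 0 := by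
          refine Finset.sum_le_sum fun d _ => ?_
          rcases Nat.eq_zero_or_pos d with rfl | hd
          · simp
          have hinj : Function.Injective fun n : ℕ => d * n := mul_right_injective₀ hd.ne'
          have := tsum_comp_le_tsum_of_inj (hsd d) (fun n => by
            split_ifs
            · exact mul_nonneg vonMangoldt_nonneg (by positivity)
            · exact le_rfl) hinj
          simpa [Function.comp_def] using this
      _ = ∑' n : ℕ, ∑ d ∈ F, if d ∣ n then vonMangoldt d * (n : ℝ) ^ (-(1 + t)) else 0 :=
          (Summable.tsum_finsetSum fun d _ => hsd d).symm
      _ ≤ _ := by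
          refine Summable.tsum_le_tsum (fun n => ?_) (summable_sum fun d _ => hsd d) hs
          rcases Nat.eq_zero_or_pos n with rfl | hn
          · simp only [Nat.cast_zero, Real.zero_rpow (show -(1 + t) ≠ 0 by linarith), mul_zero,
              ite_self, Finset.sum_const_zero, le_refl]
          rw [← vonMangoldt_sum, Finset.sum_mul, ← Finset.sum_filter]
          refine Finset.sum_le_sum_of_subset_of_nonneg (fun d hd => ?_) fun d _ _ =>
            mul_nonneg vonMangoldt_nonneg (by positivity)
          exact Nat.mem_divisors.2 ⟨(Finset.mem_filter.1 hd).2, hn.ne'⟩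
  rw [le_div_iff₀ (by linarith)]
  have h := tsum_log_mul_rpow_le ht
  have h1 := mul_le_mul_of_nonneg_right key (sub_pos.2 h2t).le
  refine le_of_mul_le_mul_right ?_ hzpos
  linarith

end MangoldtSeries

section Kernel

open ArithmeticFunction MeasureTheory Set

/-- The kernel whose Laplace transform is `u ↦ 1 / ((M + u) (M + L + u))`. -/
noncomputable def laplaceKernel (M L t : ℝ) : ℝ :=
  (Real.exp (-(M * t)) - Real.exp (-((M + L) * t))) / L

theorem laplaceKernel_nonneg {M L t : ℝ} (hL : 0 < L) (ht : 0 < t) : 0 ≤ laplaceKernel M L t := by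
  refine div_nonneg (sub_nonneg.2 (Real.exp_le_exp.2 ?_)) hL.le
  nlinarith [mul_pos hL ht]

theorem integrableOn_exp_neg_mul {a : ℝ} (ha : 0 < a) :
    IntegrableOn (fun t => Real.exp (-(a * t))) (Ioi 0) := by
  simpa using integrableOn_exp_mul_Ioi (neg_lt_zero.2 ha) 0

theorem integral_exp_neg_mul {a : ℝ} (ha : 0 < a) :
    ∫ t in Ioi 0, Real.exp (-(a * t)) = 1 / a := by
  have := integral_exp_mul_Ioi (neg_lt_zero.2 ha) 0
  simpa [neg_div_neg_eq] using this

theorem exp_mul_laplaceKernel (M L u t : ℝ) : Real.exp (-(u * t)) * laplaceKernel M L t =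
    (Real.exp (-((M + u) * t)) - Real.exp (-((M + L + u) * t))) / L := by
  rw [laplaceKernel, mul_div_assoc', mul_sub, ← Real.exp_add, ← Real.exp_add]
  ring_nf

theorem integrableOn_exp_mul_laplaceKernel {M L u : ℝ} (hL : 0 < L) (hu : 0 < M + u) :
    IntegrableOn (fun t => Real.exp (-(u * t)) * laplaceKernel M L t) (Ioi 0) := by
  simp_rw [exp_mul_laplaceKernel]
  exact ((integrableOn_exp_neg_mul hu).sub (integrableOn_exp_neg_mul (by linarith))).div_const L

theorem integral_exp_mul_laplaceKernel {M L u : ℝ} (hL : 0 < L) (hu : 0 < M + u) :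
    ∫ t in Ioi 0, Real.exp (-(u * t)) * laplaceKernel M L t = 1 / ((M + u) * (M + L + u)) := by
  simp_rw [exp_mul_laplaceKernel]
  rw [integral_div, integral_sub (integrableOn_exp_neg_mul hu)
    (integrableOn_exp_neg_mul (by linarith)), integral_exp_neg_mul hu,
    integral_exp_neg_mul (by linarith)]
  have : M + L + u ≠ 0 := by linarith
  field_simp
  ring

theorem sum_vonMangoldt_div_le_integral {M L : ℝ} (hM : 0 ≤ M) (hL : 0 < L) {G : ℝ → ℝ}
    (hG : IntegrableOn G (Ioi 0))
    (hle : ∀ t, 0 < t → Real.log 2 / ((2 : ℝ) ^ t - 1) * laplaceKernel M L t ≤ G t)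
    (F : Finset ℕ) :
    ∑ d ∈ F, vonMangoldt d / d * (1 / ((M + Real.log d) * (M + L + Real.log d))) ≤
      ∫ t in Ioi 0, G t := by
  have hF : ∑ d ∈ F, vonMangoldt d / d * (1 / ((M + Real.log d) * (M + L + Real.log d))) =
      ∑ d ∈ F.filter (1 < ·), vonMangoldt d / d *
        ∫ t in Ioi 0, Real.exp (-(Real.log d * t)) * laplaceKernel M L t := by
    rw [← Finset.sum_filter_of_ne (p := (1 < ·))]
    · refine Finset.sum_congr rfl fun d hd => ?_
      have := Real.log_pos (show (1 : ℝ) < d by exact_mod_cast (Finset.mem_filter.1 hd).2)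
      rw [integral_exp_mul_laplaceKernel hL (by linarith)]
    · intro d _ hne
      by_contra hd
      interval_cases d <;> simp at hne
  have hi : ∀ d ∈ F.filter (1 < ·), IntegrableOn (fun t => vonMangoldt d / d *
      (Real.exp (-(Real.log d * t)) * laplaceKernel M L t)) (Ioi 0) := fun d hd => by
    have := Real.log_pos (show (1 : ℝ) < d by exact_mod_cast (Finset.mem_filter.1 hd).2)
    exact (integrableOn_exp_mul_laplaceKernel hL (by linarith)).const_mul _
  rw [hF]
  simp_rw [← integral_const_mul]
  rw [← integral_finsetSum _ hi]
  refine setIntegral_mono_on (integrable_finsetSum _ hi) hG measurableSet_Ioi fun t ht => ?_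
  refine le_trans ?_ (hle t ht)
  have hs := sum_vonMangoldt_mul_rpow_le ht (F.filter (1 < ·))
  refine le_trans (le_of_eq ?_) (mul_le_mul_of_nonneg_right hs (laplaceKernel_nonneg hL ht))
  rw [Finset.sum_mul]
  refine Finset.sum_congr rfl fun d hd => ?_
  have hd0 : (0 : ℝ) < d := by
    have := (Finset.mem_filter.1 hd).2
    exact_mod_cast (by omega : 0 < d)
  rw [neg_add, Real.rpow_add hd0, Real.rpow_neg_one, Real.rpow_def_of_pos hd0]
  ring_nf

theorem sum_vonMangoldt_div_log_two_le {M : ℝ} (hM : 0 ≤ M) (F : Finset ℕ) :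
    ∑ d ∈ F, vonMangoldt d / d * (1 / ((M + Real.log d) * (M + Real.log 2 + Real.log d))) ≤
      1 / (M + Real.log 2) := by
  have hl : 0 < Real.log 2 := Real.log_pos one_lt_two
  rw [← integral_exp_neg_mul (show 0 < M + Real.log 2 by linarith)]
  refine sum_vonMangoldt_div_le_integral hM hl (integrableOn_exp_neg_mul (by linarith)) ?_ F
  intro t ht
  have h2 : 1 < (2 : ℝ) ^ t := Real.one_lt_rpow one_lt_two ht
  rw [laplaceKernel, add_mul, neg_add, Real.exp_add, Real.exp_neg (Real.log 2 * t),
    ← Real.rpow_def_of_pos two_pos]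
  have : (2 : ℝ) ^ t - 1 ≠ 0 := by linarith
  have : (2 : ℝ) ^ t ≠ 0 := by linarith
  refine le_of_eq ?_
  field_simp

theorem log_two_div_le {t : ℝ} (ht : 0 < t) :
    Real.log 2 / ((2 : ℝ) ^ t - 1) ≤
      Real.log 2 * Real.exp (-(Real.log 2 * t)) + t⁻¹ * Real.exp (-(3 / 2 * Real.log 2 * t)) := by
  have hl : 0 < Real.log 2 := Real.log_pos one_lt_two
  set y := Real.exp (Real.log 2 * t / 2) with hy
  have hy1 : 1 < y := Real.one_lt_exp_iff.2 (by positivity)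
  have e1 : (2 : ℝ) ^ t = y ^ 2 := by
    rw [Real.rpow_def_of_pos two_pos, hy, ← Real.exp_nat_mul]; ring_nf
  have e2 : Real.exp (-(Real.log 2 * t)) = (y ^ 2)⁻¹ := by
    rw [Real.exp_neg, ← e1, Real.rpow_def_of_pos two_pos]
  have e3 : Real.exp (-(3 / 2 * Real.log 2 * t)) = (y ^ 3)⁻¹ := by
    rw [Real.exp_neg, hy, ← Real.exp_nat_mul]; ring_nf
  have hs := Real.self_le_sinh_iff.2 (show 0 ≤ Real.log 2 * t / 2 by positivity)
  rw [Real.sinh_eq, Real.exp_neg, ← hy] at hs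
  have hs' : Real.log 2 * t * y ≤ y ^ 2 - 1 := by
    have := mul_le_mul_of_nonneg_right hs (show 0 ≤ 2 * y by linarith)
    have h' : (y - y⁻¹) / 2 * (2 * y) = y ^ 2 - 1 := by field_simp
    linarith
  rw [e1, e2, e3]
  have hy2 : 0 < y ^ 2 - 1 := by nlinarith
  have : Real.log 2 * (y ^ 2)⁻¹ + t⁻¹ * (y ^ 3)⁻¹ - Real.log 2 / (y ^ 2 - 1) =
      (y ^ 2 - 1 - Real.log 2 * t * y) / (t * y ^ 3 * (y ^ 2 - 1)) := by
    field_simp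
    ring
  have h2 : 0 ≤ (y ^ 2 - 1 - Real.log 2 * t * y) / (t * y ^ 3 * (y ^ 2 - 1)) :=
    div_nonneg (by linarith) (by positivity)
  linarith

theorem integrableOn_inv_mul_exp_sub {a b : ℝ} (ha : 0 < a) (hab : a ≤ b) :
    IntegrableOn (fun t => t⁻¹ * (Real.exp (-(a * t)) - Real.exp (-(b * t)))) (Ioi 0) := by
  refine Integrable.mono' ((integrableOn_exp_neg_mul ha).const_mul (b - a)) ?_ ?_
  · refine ContinuousOn.aestronglyMeasurable ?_ measurableSet_Ioi
    refine ContinuousOn.mul (continuousOn_inv₀.mono fun x hx => ne_of_gt hx) ?_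
    fun_prop
  · refine (ae_restrict_iff' measurableSet_Ioi).2 (Filter.Eventually.of_forall fun t ht => ?_)
    have ht' : 0 < t := ht
    have h1 : Real.exp (-(b * t)) = Real.exp (-(a * t)) * Real.exp (-((b - a) * t)) := by
      rw [← Real.exp_add]; ring_nf
    have h2 := Real.add_one_le_exp (-((b - a) * t))
    have h3 : Real.exp (-((b - a) * t)) ≤ 1 :=
      Real.exp_le_one_iff.2 (by nlinarith [mul_nonneg (sub_nonneg.2 hab) ht'.le])
    have h4 := Real.exp_pos (-(a * t))
    rw [h1, Real.norm_of_nonneg (mul_nonneg (by positivity) (by nlinarith)),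
      inv_mul_le_iff₀ ht']
    nlinarith

theorem integral_inv_mul_exp_sub {a b : ℝ} (ha : 0 < a) (hab : a ≤ b) :
    ∫ t in Ioi 0, t⁻¹ * (Real.exp (-(a * t)) - Real.exp (-(b * t))) = Real.log (b / a) := by
  have h := Frullani.integral_Ioi_eq (f := fun x => Real.exp (-x)) (L := 1) (R := 0)
    (Continuous.locallyIntegrable (by fun_prop) |>.locallyIntegrableOn _) ha (by linarith : 0 < b)
    ?_ ?_ (by simpa using integrableOn_inv_mul_exp_sub ha hab)
  · simpa using h
  · have : Filter.Tendsto (fun x : ℝ => Real.exp (-x)) (nhds 0) (nhds (Real.exp (-0))) :=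
      Continuous.tendsto (by fun_prop) 0
    rw [neg_zero, Real.exp_zero] at this
    exact this.mono_left nhdsWithin_le_nhds
  · exact Real.tendsto_exp_neg_atTop_nhds_zero

theorem sum_vonMangoldt_div_le {M L : ℝ} (hM : 0 < M) (hL : 0 < L) (F : Finset ℕ) :
    ∑ d ∈ F, vonMangoldt d / d * (1 / ((M + Real.log d) * (M + L + Real.log d))) ≤
      Real.log 2 / ((M + Real.log 2) * (M + L + Real.log 2)) +
        Real.log ((M + L + 3 / 2 * Real.log 2) / (M + 3 / 2 * Real.log 2)) / L := by
  have hl : 0 < Real.log 2 := Real.log_pos one_lt_two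
  have i1 := (integrableOn_exp_mul_laplaceKernel (u := Real.log 2) hL
    (show 0 < M + Real.log 2 by linarith)).const_mul (Real.log 2)
  have i2 := (integrableOn_inv_mul_exp_sub (show 0 < M + 3 / 2 * Real.log 2 by positivity)
    (show _ ≤ M + L + 3 / 2 * Real.log 2 by linarith)).div_const L
  refine (sum_vonMangoldt_div_le_integral hM.le hL (i1.add i2) (fun t ht => ?_) F).trans
    (le_of_eq ?_)
  · refine (mul_le_mul_of_nonneg_right (log_two_div_le ht)
      (laplaceKernel_nonneg hL ht)).trans (le_of_eq ?_)
    have := exp_mul_laplaceKernel M L (3 / 2 * Real.log 2) t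
    simp only [Pi.add_apply]
    linear_combination t⁻¹ * this
  · simp only [Pi.add_apply]
    rw [integral_add i1 i2, integral_const_mul, integral_exp_mul_laplaceKernel hL (by linarith),
      integral_div, integral_inv_mul_exp_sub (by positivity) (by linarith)]
    ring

end Kernel

section Subinvariance

open ArithmeticFunction Finset

theorem log_one_add_le {z : ℝ} (hz : 0 ≤ z) : Real.log (1 + z) ≤ z * (6 + z) / (6 + 4 * z) := by
  have hd : ∀ x : ℝ, 0 ≤ x → HasDerivAt (fun y => y * (6 + y) / (6 + 4 * y) - Real.log (1 + y))
      (((1 * (6 + x) + x * 1) * (6 + 4 * x) - x * (6 + x) * (4 * 1)) / (6 + 4 * x) ^ 2 -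
        1 / (1 + x)) x := by
    intro x hx
    have h6 : 6 + 4 * x ≠ 0 := by positivity
    have h1 : 1 + x ≠ 0 := by positivity
    exact (((hasDerivAt_id x).mul ((hasDerivAt_id x).const_add 6)).div
      (((hasDerivAt_id x).const_mul 4).const_add 6) h6).sub
      (((hasDerivAt_id x).const_add 1).log h1)
  have hmono : MonotoneOn (fun y : ℝ => y * (6 + y) / (6 + 4 * y) - Real.log (1 + y))
      (Set.Ici 0) := by
    refine monotoneOn_of_hasDerivWithinAt_nonneg (convex_Ici 0)
      (fun x hx => (hd x hx).continuousAt.continuousWithinAt)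
      (fun x hx => (hd x (interior_subset hx)).hasDerivWithinAt) fun x hx => ?_
    have hx' : 0 ≤ x := interior_subset hx
    rw [sub_nonneg, div_le_div_iff₀ (by positivity) (by positivity)]
    nlinarith [pow_nonneg hx' 3]
  have := hmono (Set.mem_Ici.2 le_rfl) (Set.mem_Ici.2 hz) hz
  simpa using this

theorem log_div_div_le {X L : ℝ} (hX : 0 < X) (hL : 0 < L) :
    Real.log ((X + L) / X) / L ≤ (6 * X + L) / (X * (6 * X + 4 * L)) := by
  have h := log_one_add_le (show 0 ≤ L / X by positivity)
  rw [show (X + L) / X = 1 + L / X by field_simp, div_le_iff₀ hL]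
  refine h.trans (le_of_eq ?_)
  field_simp

theorem log_factorial_le_sum_vonMangoldt (n : ℕ) :
    Real.log n.factorial ≤ n * ∑ d ∈ Icc 2 n, vonMangoldt d / d := by
  have h1 : Real.log n.factorial = ∑ m ∈ Icc 1 n, ∑ d ∈ Icc 1 n,
      if d ∣ m then vonMangoldt d else 0 := by
    have hfac : n.factorial = ∏ m ∈ Icc 1 n, m := by
      rw [← prod_Ico_id_eq_factorial]
      rfl
    rw [hfac, Nat.cast_prod, Real.log_prod]
    · refine sum_congr rfl fun m hm => ?_
      rw [mem_Icc] at hm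
      rw [← vonMangoldt_sum, ← sum_filter]
      refine sum_congr ?_ fun _ _ => rfl
      ext d
      simp only [Nat.mem_divisors, mem_filter, mem_Icc]
      constructor
      · rintro ⟨hd, -⟩
        have := Nat.le_of_dvd (by omega) hd
        have : 0 < d := Nat.pos_of_dvd_of_pos hd (by omega)
        exact ⟨by omega, hd⟩
      · exact fun hd => ⟨hd.2, by omega⟩
    · intro m hm
      rw [mem_Icc] at hm
      exact_mod_cast (by omega : m ≠ 0)
  rw [h1, sum_comm, mul_sum]
  refine le_of_le_of_eq (b := ∑ d ∈ Icc 1 n, n * (vonMangoldt d / d)) (sum_le_sum fun d hd => ?_) ?_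
  · rw [← sum_filter, sum_const, nsmul_eq_mul,
      show ((Icc 1 n).filter (d ∣ ·)).card = n / d from Nat.Ioc_filter_dvd_card_eq_div n d]
    have h2 : ((n / d : ℕ) : ℝ) ≤ n / d := Nat.cast_div_le
    have := mul_le_mul_of_nonneg_right h2 (vonMangoldt_nonneg (n := d))
    refine this.trans (le_of_eq (by ring))
  · refine (sum_subset (fun d hd => ?_) fun d hd hd' => ?_).symm
    · rw [mem_Icc] at hd ⊢; omega
    · rw [mem_Icc] at hd hd'
      obtain rfl : d = 1 := by omega
      simp

theorem mul_log_succ_sub_le_log_factorial (n : ℕ) :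
    n * Real.log (n + 1) - n ≤ Real.log n.factorial := by
  induction n with
  | zero => simp
  | succ n ih =>
    have h1 : (0 : ℝ) < n + 1 := by positivity
    have h2 : (0 : ℝ) < n + 1 + 1 := by positivity
    rw [Nat.factorial_succ, Nat.cast_mul, Real.log_mul (by positivity) (by positivity)]
    push_cast
    have h3 := Real.log_le_sub_one_of_pos (div_pos h2 h1)
    rw [Real.log_div h2.ne' h1.ne', show ((n : ℝ) + 1 + 1) / (n + 1) - 1 = 1 / (n + 1) by
      field_simp; ring, le_div_iff₀ h1] at h3
    linarith

theorem log_succ_sub_one_le_sum_vonMangoldt {n : ℕ} (hn : 0 < n) :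
    Real.log (n + 1) - 1 ≤ ∑ d ∈ Icc 2 n, vonMangoldt d / d := by
  have h := (mul_log_succ_sub_le_log_factorial n).trans (log_factorial_le_sum_vonMangoldt n)
  have hn' : (0 : ℝ) < n := by exact_mod_cast hn
  refine le_of_mul_le_mul_left ?_ hn'
  linarith

/-- The primitive `u ↦ log ((M + u) / (M + L + u)) / L` of the kernel
`u ↦ 1 / ((M + u) (M + L + u))` grows at most at the rate given by the left endpoint. -/
theorem log_ratio_sub_le {M L u v : ℝ} (hL : 0 < L) (hu : 0 < M + u) (huv : u ≤ v) :
    Real.log ((M + v) / (M + L + v)) / L - Real.log ((M + u) / (M + L + u)) / L ≤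
      (v - u) * (1 / ((M + u) * (M + L + u))) := by
  have hv : 0 < M + v := by linarith
  have hu' : 0 < M + L + u := by linarith
  have hv' : 0 < M + L + v := by linarith
  rw [← sub_div, ← Real.log_div (by positivity) (by positivity), div_le_iff₀ hL]
  refine (Real.log_le_sub_one_of_pos (by positivity)).trans ?_
  have : (M + v) / (M + L + v) / ((M + u) / (M + L + u)) - 1 =
      L * (v - u) / ((M + u) * (M + L + v)) := by
    field_simp
    ring
  rw [this, show (v - u) * (1 / ((M + u) * (M + L + u))) * L =
    L * (v - u) / ((M + u) * (M + L + u)) by ring]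
  have : 0 ≤ L * (v - u) := mul_nonneg hL.le (by linarith)
  gcongr

theorem one_div_mul_le {M L L' a u : ℝ} (ha : 0 < M + a) (hL : 0 ≤ L) (hL' : L ≤ L') (hu : a ≤ u) :
    1 / ((M + u) * (M + L' + u)) ≤ 1 / ((M + a) * (M + L + a)) :=
  one_div_le_one_div_of_le (mul_pos ha (by linarith))
    (mul_le_mul (by linarith) (by linarith) (by linarith) (by linarith))

theorem sum_vonMangoldt_small_ge {M L : ℝ} (hM : 0 < M) (hL : 0 < L) {n : ℕ} (hn : 2 ≤ n) :
    Real.log 2 / 2 * (1 / ((M + Real.log 2) * (M + L + Real.log 2))) +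
      Real.log ((M + Real.log (n + 1)) / (M + L + Real.log (n + 1))) / L -
      Real.log ((M + Real.log 3) / (M + L + Real.log 3)) / L -
      (Real.log 2 / 2 - (Real.log 3 - 1)) * (1 / ((M + Real.log 3) * (M + L + Real.log 3))) -
      (Real.log (n + 1) - 1) *
        (1 / ((M + Real.log (n + 1)) * (M + L + Real.log (n + 1)))) ≤
    ∑ d ∈ Icc 2 n, vonMangoldt d / d * (1 / ((M + Real.log d) * (M + L + Real.log d))) -
      (∑ d ∈ Icc 2 n, vonMangoldt d / d) *
        (1 / ((M + Real.log (n + 1)) * (M + L + Real.log (n + 1)))) := by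
  induction n, hn using Nat.le_induction with
  | base =>
    rw [Icc_self, sum_singleton, sum_singleton, vonMangoldt_apply_prime Nat.prime_two]
    norm_num
    ring_nf
    exact le_rfl
  | succ n hn ih =>
    rw [sum_Icc_succ_top (by omega), sum_Icc_succ_top (by omega)]
    have hS := log_succ_sub_one_le_sum_vonMangoldt (n := n + 1) (by omega)
    rw [sum_Icc_succ_top (by omega)] at hS
    push_cast at hS ⊢
    set u := Real.log ((n : ℝ) + 1) with hu
    set v := Real.log ((n : ℝ) + 1 + 1) with hv
    have hu0 : 0 < u := Real.log_pos (by
      have : (2 : ℝ) ≤ n := by exact_mod_cast hn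
      linarith)
    have huv : u ≤ v := Real.log_le_log (by positivity) (by linarith)
    have h1 := log_ratio_sub_le hL (show 0 < M + u by linarith) huv
    have hφ : 1 / ((M + v) * (M + L + v)) ≤ 1 / ((M + u) * (M + L + u)) := one_div_mul_le (by linarith) hL.le le_rfl huv
    set φu := 1 / ((M + u) * (M + L + u))
    set φv := 1 / ((M + v) * (M + L + v))
    have h2 := mul_le_mul_of_nonneg_right hS (sub_nonneg.2 hφ)
    linarith

theorem sum_add_sum_small_le {M L : ℝ} (hM : 0 < M) (hL : 0 < L) {q : ℕ} {F D : Finset ℕ}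
    (hF : ∀ d ∈ F, q ≤ d) (hD : ∀ d ∈ D, d < q) :
    ∑ d ∈ F, vonMangoldt d / d * (1 / ((M + Real.log d) * (M + L + Real.log d))) +
      ∑ d ∈ D, vonMangoldt d / d * (1 / ((M + Real.log d) * (M + L + Real.log d))) ≤
      Real.log 2 / ((M + Real.log 2) * (M + L + Real.log 2)) +
        Real.log ((M + L + 3 / 2 * Real.log 2) / (M + 3 / 2 * Real.log 2)) / L := by
  rw [← sum_union]
  · exact sum_vonMangoldt_div_le hM hL _
  · exact disjoint_left.2 fun d h1 h2 => absurd (hF d h1) (not_le.2 (hD d h2))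

theorem sum_vonMangoldt_rough_le_of_large {q : ℕ} (hq : 4 ≤ q) (hL : 2.39 ≤ Real.log q) {M : ℝ}
    (hM : Real.log q ≤ M) {F : Finset ℕ} (hF : ∀ d ∈ F, q ≤ d) :
    ∑ d ∈ F, vonMangoldt d / d * (1 / ((M + Real.log d) * (M + Real.log q + Real.log d))) ≤
      1 / (M + Real.log q) := by
  have h1 := sum_add_sum_small_le (M := M) (L := Real.log q) (by linarith) (by linarith) hF
    (D := Icc 2 (q - 1)) (fun d hd => by rw [mem_Icc] at hd; omega)
  have h2 := sum_vonMangoldt_small_ge (M := M) (L := Real.log q) (by linarith) (by linarith)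
    (n := q - 1) (by omega)
  have h3 := log_succ_sub_one_le_sum_vonMangoldt (n := q - 1) (by omega)
  have hcast : ((q - 1 : ℕ) : ℝ) + 1 = q := by
    rw [Nat.cast_sub (by omega)]; simp
  rw [hcast] at h2 h3
  set L := Real.log q
  have hL0 : 0 < L := by linarith
  have hM0 : 0 < M := by linarith
  have l0 := Real.log_two_gt_d9
  have l1 := Real.log_two_lt_d9
  have t0 := Real.log_three_gt_d9
  have t1 := Real.log_three_lt_d9
  have h4 := log_ratio_sub_le (M := M) (L := L) (u := 3 / 2 * Real.log 2) (v := Real.log 3)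
    (by linarith) (by linarith) (by linarith)
  have h5 := log_div_div_le (X := M + L) (L := L) (by linarith) (by linarith)
  have e1 : Real.log ((M + L + 3 / 2 * Real.log 2) / (M + 3 / 2 * Real.log 2)) =
      -Real.log ((M + 3 / 2 * Real.log 2) / (M + L + 3 / 2 * Real.log 2)) := by
    rw [← Real.log_inv, inv_div]
  have e2 : Real.log ((M + L) / (M + L + L)) = -Real.log ((M + L + L) / (M + L)) := by
    rw [← Real.log_inv, inv_div]
  rw [e1, neg_div] at h1
  rw [e2, neg_div] at h2
  have hS := mul_le_mul_of_nonneg_right h3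
    (show 0 ≤ 1 / ((M + L) * (M + L + L)) from one_div_nonneg.2 (by nlinarith))
  have b1 := mul_le_mul (show Real.log 2 / 2 ≤ 0.3466 by linarith)
    (one_div_mul_le (M := M) (a := 0.6931) (u := Real.log 2) (by linarith) (by linarith)
      (le_refl L) (by linarith)) (one_div_nonneg.2 (by positivity)) (by norm_num)
  have b2 := mul_le_mul_of_nonneg_left
    (one_div_mul_le (M := M) (a := 1.0396) (u := 3 / 2 * Real.log 2) (by linarith) (by linarith)
      (le_refl L) (by linarith)) (show 0 ≤ Real.log 3 - 3 / 2 * Real.log 2 by linarith)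
  have b3 := mul_le_mul_of_nonneg_left
    (one_div_mul_le (M := M) (a := 1.0396) (u := Real.log 3) (by linarith) (by linarith)
      (le_refl L) (by linarith)) (show 0 ≤ Real.log 2 / 2 - (Real.log 3 - 1) by linarith)
  have b4 := mul_le_mul_of_nonneg_right (show 1 - Real.log 2 ≤ 0.307 by linarith)
    (show 0 ≤ 1 / ((M + 1.0396) * (M + L + 1.0396)) by positivity)
  have key : 0.3466 * (1 / ((M + 0.6931) * (M + L + 0.6931))) +
      0.307 * (1 / ((M + 1.0396) * (M + L + 1.0396))) +
      (6 * (M + L) + L) / ((M + L) * (6 * (M + L) + 4 * L)) ≤ 1 / (M + L) := by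
    obtain ⟨r, hr⟩ : ∃ r, L = 2.39 + r := ⟨L - 2.39, by ring⟩
    obtain ⟨s, hs⟩ : ∃ s, M = 2.39 + r + s := ⟨M - L, by rw [hr]; ring⟩
    have hr0 : 0 ≤ r := by linarith
    have hs0 : 0 ≤ s := by linarith
    rw [hr, hs, ← sub_nonneg]
    norm_num only
    field_simp
    ring_nf
    positivity
  have e3 : Real.log 2 / ((M + Real.log 2) * (M + L + Real.log 2)) =
    2 * (Real.log 2 / 2 * (1 / ((M + Real.log 2) * (M + L + Real.log 2)))) := by ring
  rw [e3] at h1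
  linarith

theorem log_ratio_div_le {M L L₀ : ℝ} (hM : 0 < M) (hL₀ : 0 < L₀) (hL : L₀ ≤ L) :
    Real.log ((M + L + 3 / 2 * Real.log 2) / (M + 3 / 2 * Real.log 2)) / L ≤
      (6 * (M + 1.0396) + L₀) / ((M + 1.0396) * (6 * (M + 1.0396) + 4 * L₀)) := by
  have l0 := Real.log_two_gt_d9
  have hX : 0 < M + 3 / 2 * Real.log 2 := by linarith
  rw [add_right_comm]
  refine (log_div_div_le hX (by linarith)).trans ?_
  obtain ⟨x, hx⟩ : ∃ x, M + 3 / 2 * Real.log 2 = M + 1.0396 + x :=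
    ⟨3 / 2 * Real.log 2 - 1.0396, by ring⟩
  obtain ⟨y, rfl⟩ : ∃ y, L = L₀ + y := ⟨L - L₀, by ring⟩
  have hx0 : 0 ≤ x := by linarith
  have hy0 : 0 ≤ y := by linarith
  rw [hx]
  set Y := M + 1.0396 with hY
  have hY0 : 0 < Y := by linarith
  rw [div_le_div_iff₀ (by positivity) (by positivity), ← sub_nonneg]
  ring_nf
  positivity

theorem log_seven_bounds : 1.945 < Real.log 7 ∧ Real.log 7 < 1.9463 := by
  have l0 := Real.log_two_gt_d9
  have l1 := Real.log_two_lt_d9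
  constructor
  · have : Real.log (2 ^ 87) ≤ Real.log (7 ^ 31) := Real.log_le_log (by norm_num) (by norm_num)
    rw [Real.log_pow, Real.log_pow] at this
    norm_num at this
    linarith
  · have : Real.log (7 ^ 26) ≤ Real.log (2 ^ 73) := Real.log_le_log (by norm_num) (by norm_num)
    rw [Real.log_pow, Real.log_pow] at this
    norm_num at this
    linarith

end Subinvariance

section SmallPrimes

open ArithmeticFunction Finset

theorem sum_vonMangoldt_rough_three_le {M : ℝ} (hM : Real.log 3 ≤ M) {F : Finset ℕ}
    (hF : ∀ d ∈ F, 3 ≤ d) :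
    ∑ d ∈ F, vonMangoldt d / d * (1 / ((M + Real.log d) * (M + Real.log 3 + Real.log d))) ≤
      1 / (M + Real.log 3) := by
  have l0 := Real.log_two_gt_d9
  have l1 := Real.log_two_lt_d9
  have t0 := Real.log_three_gt_d9
  have t1 := Real.log_three_lt_d9
  have hM0 : 0 < M := by linarith
  have h1 := sum_add_sum_small_le (M := M) (L := Real.log 3) hM0 (by linarith) hF
    (D := {2}) (by decide)
  rw [sum_singleton, vonMangoldt_apply_prime Nat.prime_two, Nat.cast_ofNat] at h1
  have h2 := log_ratio_div_le (M := M) (L := Real.log 3) (L₀ := 1.0986) hM0 (by norm_num)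
    (by linarith)
  have b1 := mul_le_mul (show Real.log 2 / 2 ≤ 0.3466 by linarith)
    (one_div_mul_le (M := M) (a := 0.6931) (u := Real.log 2) (by linarith) (by norm_num)
      (show 1.0986 ≤ Real.log 3 by linarith) (by linarith)) (one_div_nonneg.2 (by positivity))
      (by norm_num)
  have b2 : 1 / (M + 1.0987) ≤ 1 / (M + Real.log 3) :=
    one_div_le_one_div_of_le (by linarith) (by linarith)
  have key : 0.3466 * (1 / ((M + 0.6931) * (M + 1.0986 + 0.6931))) +
      (6 * (M + 1.0396) + 1.0986) / ((M + 1.0396) * (6 * (M + 1.0396) + 4 * 1.0986)) ≤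
      1 / (M + 1.0987) := by
    obtain ⟨s, hs⟩ : ∃ s, M = 1.0986 + s := ⟨M - 1.0986, by ring⟩
    have hs0 : 0 ≤ s := by linarith
    rw [hs, ← sub_nonneg]
    norm_num only
    field_simp
    ring_nf
    positivity
  have e3 : Real.log 2 / ((M + Real.log 2) * (M + Real.log 3 + Real.log 2)) =
    2 * (Real.log 2 / 2 * (1 / ((M + Real.log 2) * (M + Real.log 3 + Real.log 2)))) := by ring
  rw [e3] at h1
  linarith

theorem sum_vonMangoldt_rough_five_le {M : ℝ} (hM : Real.log 5 ≤ M) {F : Finset ℕ}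
    (hF : ∀ d ∈ F, 5 ≤ d) :
    ∑ d ∈ F, vonMangoldt d / d * (1 / ((M + Real.log d) * (M + Real.log 5 + Real.log d))) ≤
      1 / (M + Real.log 5) := by
  have l0 := Real.log_two_gt_d9
  have l1 := Real.log_two_lt_d9
  have t0 := Real.log_three_gt_d9
  have t1 := Real.log_three_lt_d9
  have f0 := Real.log_five_gt_d9
  have f1 := Real.log_five_lt_d9
  have hM0 : 0 < M := by linarith
  have h1 := sum_add_sum_small_le (M := M) (L := Real.log 5) hM0 (by linarith) hF
    (D := {2, 3}) (by decide)
  rw [sum_insert (by decide), sum_singleton, vonMangoldt_apply_prime Nat.prime_two,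
    vonMangoldt_apply_prime Nat.prime_three, Nat.cast_ofNat, Nat.cast_ofNat] at h1
  have h2 := log_ratio_div_le (M := M) (L := Real.log 5) (L₀ := 1.6094) hM0 (by norm_num)
    (by linarith)
  have b1 := mul_le_mul (show Real.log 2 / 2 ≤ 0.3466 by linarith)
    (one_div_mul_le (M := M) (a := 0.6931) (u := Real.log 2) (by linarith) (by norm_num)
      (show 1.6094 ≤ Real.log 5 by linarith) (by linarith)) (one_div_nonneg.2 (by positivity))
      (by norm_num)
  have b3 := mul_le_mul (show 0.3662 ≤ Real.log 3 / 3 by linarith)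
    (one_div_mul_le (M := M) (a := Real.log 3) (u := 1.0987) (by linarith) (by linarith)
      (show Real.log 5 ≤ 1.6095 by linarith) (by linarith)) (one_div_nonneg.2 (by positivity))
      (by linarith)
  have b2 : 1 / (M + 1.6095) ≤ 1 / (M + Real.log 5) :=
    one_div_le_one_div_of_le (by linarith) (by linarith)
  have key : 0.3466 * (1 / ((M + 0.6931) * (M + 1.6094 + 0.6931))) +
      (6 * (M + 1.0396) + 1.6094) / ((M + 1.0396) * (6 * (M + 1.0396) + 4 * 1.6094)) ≤
      1 / (M + 1.6095) + 0.3662 * (1 / ((M + 1.0987) * (M + 1.6095 + 1.0987))) := by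
    obtain ⟨s, hs⟩ : ∃ s, M = 1.6094 + s := ⟨M - 1.6094, by ring⟩
    have hs0 : 0 ≤ s := by linarith
    rw [hs, ← sub_nonneg]
    norm_num only
    field_simp
    ring_nf
    positivity
  have e3 : Real.log 2 / ((M + Real.log 2) * (M + Real.log 5 + Real.log 2)) =
    2 * (Real.log 2 / 2 * (1 / ((M + Real.log 2) * (M + Real.log 5 + Real.log 2)))) := by ring
  rw [e3] at h1
  linarith

theorem sum_vonMangoldt_rough_seven_le {M : ℝ} (hM : Real.log 7 ≤ M) {F : Finset ℕ}
    (hF : ∀ d ∈ F, 7 ≤ d) :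
    ∑ d ∈ F, vonMangoldt d / d * (1 / ((M + Real.log d) * (M + Real.log 7 + Real.log d))) ≤
      1 / (M + Real.log 7) := by
  have l0 := Real.log_two_gt_d9
  have l1 := Real.log_two_lt_d9
  have t0 := Real.log_three_gt_d9
  have t1 := Real.log_three_lt_d9
  have f0 := Real.log_five_gt_d9
  have f1 := Real.log_five_lt_d9
  obtain ⟨s0, s1⟩ := log_seven_bounds
  have hM0 : 0 < M := by linarith
  have h1 := sum_add_sum_small_le (M := M) (L := Real.log 7) hM0 (by linarith) hF
    (D := {2, 3, 5}) (by decide)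
  rw [sum_insert (by decide), sum_insert (by decide), sum_singleton,
    vonMangoldt_apply_prime Nat.prime_two, vonMangoldt_apply_prime Nat.prime_three,
    vonMangoldt_apply_prime Nat.prime_five, Nat.cast_ofNat, Nat.cast_ofNat, Nat.cast_ofNat] at h1
  have h2 := log_ratio_div_le (M := M) (L := Real.log 7) (L₀ := 1.945) hM0 (by norm_num)
    (by linarith)
  have b1 := mul_le_mul (show Real.log 2 / 2 ≤ 0.3466 by linarith)
    (one_div_mul_le (M := M) (a := 0.6931) (u := Real.log 2) (by linarith) (by norm_num)
      (show 1.945 ≤ Real.log 7 by linarith) (by linarith)) (one_div_nonneg.2 (by positivity))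
      (by norm_num)
  have b3 := mul_le_mul (show 0.3662 ≤ Real.log 3 / 3 by linarith)
    (one_div_mul_le (M := M) (a := Real.log 3) (u := 1.0987) (by linarith) (by linarith)
      (show Real.log 7 ≤ 1.9463 by linarith) (by linarith)) (one_div_nonneg.2 (by positivity))
      (by linarith)
  have b5 := mul_le_mul (show 0.3218 ≤ Real.log 5 / 5 by linarith)
    (one_div_mul_le (M := M) (a := Real.log 5) (u := 1.6095) (by linarith) (by linarith)
      (show Real.log 7 ≤ 1.9463 by linarith) (by linarith)) (one_div_nonneg.2 (by positivity))
      (by linarith)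
  have b2 : 1 / (M + 1.9463) ≤ 1 / (M + Real.log 7) :=
    one_div_le_one_div_of_le (by linarith) (by linarith)
  have key : 0.3466 * (1 / ((M + 0.6931) * (M + 1.945 + 0.6931))) +
      (6 * (M + 1.0396) + 1.945) / ((M + 1.0396) * (6 * (M + 1.0396) + 4 * 1.945)) ≤
      1 / (M + 1.9463) + 0.3662 * (1 / ((M + 1.0987) * (M + 1.9463 + 1.0987))) +
        0.3218 * (1 / ((M + 1.6095) * (M + 1.9463 + 1.6095))) := by
    obtain ⟨s, hs⟩ : ∃ s, M = 1.945 + s := ⟨M - 1.945, by ring⟩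
    have hs0 : 0 ≤ s := by linarith
    rw [hs, ← sub_nonneg]
    norm_num only
    field_simp
    ring_nf
    positivity
  have e3 : Real.log 2 / ((M + Real.log 2) * (M + Real.log 7 + Real.log 2)) =
    2 * (Real.log 2 / 2 * (1 / ((M + Real.log 2) * (M + Real.log 7 + Real.log 2)))) := by ring
  rw [e3] at h1
  linarith

theorem log_eleven_ge : 2.39 ≤ Real.log 11 := by
  have : Real.log (2 ^ 38) ≤ Real.log (11 ^ 11) := Real.log_le_log (by norm_num) (by norm_num)
  rw [Real.log_pow, Real.log_pow] at this
  norm_num at this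
  linarith [Real.log_two_gt_d9]

theorem sum_vonMangoldt_rough_le {q : ℕ} (hq : q.Prime) (hq2 : q ≠ 2) {M : ℝ}
    (hM : Real.log q ≤ M) {F : Finset ℕ} (hF : ∀ d ∈ F, q ≤ d) :
    ∑ d ∈ F, vonMangoldt d / d * (1 / ((M + Real.log d) * (M + Real.log q + Real.log d))) ≤
      1 / (M + Real.log q) := by
  rcases le_or_gt 11 q with h | h
  · refine sum_vonMangoldt_rough_le_of_large (by omega) (log_eleven_ge.trans ?_) hM hF
    exact Real.log_le_log (by norm_num) (by exact_mod_cast h)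
  · interval_cases q <;> first | omega | (exfalso; revert hq; norm_num; done) | skip
    · exact_mod_cast sum_vonMangoldt_rough_three_le (by exact_mod_cast hM) hF
    · exact_mod_cast sum_vonMangoldt_rough_five_le (by exact_mod_cast hM) hF
    · exact_mod_cast sum_vonMangoldt_rough_seven_le (by exact_mod_cast hM) hF

end SmallPrimes

theorem mul_rpow_le_sub_rpow {t x : ℝ} (ht : 0 < t) (hx : 1 / 2 < x) :
    t * x ^ (-(1 + t)) ≤ (x - 1 / 2) ^ (-t) - (x + 1 / 2) ^ (-t) := by
  have ha : 0 < x - 1 / 2 := by linarith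
  have hb : 0 < x + 1 / 2 := by linarith
  have hx0 : 0 < x := by linarith
  have hlog : 1 / x ≤ Real.log (x + 1 / 2) - Real.log (x - 1 / 2) := by
    have h := Real.le_log_one_add_of_nonneg (x := 1 / (x - 1 / 2)) (by positivity)
    rw [← Real.log_div hb.ne' ha.ne']
    obtain ⟨a, rfl⟩ : ∃ a, x = a + 1 / 2 := ⟨x - 1 / 2, by ring⟩
    rw [add_sub_cancel_right] at ha h ⊢
    convert h using 1
    · field_simp
      ring
    · congr 1
      field_simp
      ring
  have hmid : Real.log (x + 1 / 2) + Real.log (x - 1 / 2) ≤ 2 * Real.log x := by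
    rw [← Real.log_mul hb.ne' ha.ne', ← Real.log_rpow hx0]
    apply Real.log_le_log (by positivity)
    norm_num
    nlinarith
  set α := Real.log (x + 1 / 2)
  set β := Real.log (x - 1 / 2)
  have hsinh := Real.self_le_sinh_iff.2 (show 0 ≤ t * (α - β) / 2 by
    have : 0 ≤ 1 / x := by positivity
    have : 0 ≤ t * (α - β) := mul_nonneg ht.le (by linarith)
    linarith)
  have h1 : (x - 1 / 2) ^ (-t) - (x + 1 / 2) ^ (-t) =
      Real.exp (-(t * (α + β) / 2)) * (2 * Real.sinh (t * (α - β) / 2)) := by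
    rw [Real.rpow_def_of_pos ha, Real.rpow_def_of_pos hb, Real.sinh_eq]
    have : ∀ u v w : ℝ, Real.exp u * (2 * ((Real.exp v - Real.exp w) / 2)) =
        Real.exp (u + v) - Real.exp (u + w) := by
      intro u v w
      rw [Real.exp_add, Real.exp_add]
      ring
    rw [this]
    congr 2 <;> ring
  have h2 : x ^ (-(1 + t)) = Real.exp (-(t * Real.log x)) * (1 / x) := by
    rw [neg_add, Real.rpow_add hx0, Real.rpow_neg_one, Real.rpow_def_of_pos hx0]
    rw [mul_comm, one_div]
    congr 2
    ring
  rw [h1, h2]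
  calc t * (Real.exp (-(t * Real.log x)) * (1 / x))
      = Real.exp (-(t * Real.log x)) * (t * (1 / x)) := by ring
    _ ≤ _ := by
      apply mul_le_mul
      · apply Real.exp_le_exp.2
        nlinarith
      · nlinarith
      · positivity
      · positivity

theorem sum_range_rpow_le {t : ℝ} (ht : 0 < t) (N : ℕ) :
    ∑ n ∈ Finset.range N, (n : ℝ) ^ (-(1 + t)) ≤ 2 ^ t / t := by
  have key : ∀ N : ℕ, t * ∑ n ∈ Finset.range (N + 1), (n : ℝ) ^ (-(1 + t)) ≤
      2 ^ t - ((N : ℝ) + 1 / 2) ^ (-t) := by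
    intro N
    induction N with
    | zero =>
      simp only [zero_add, Finset.range_one, Finset.sum_singleton, Nat.cast_zero]
      rw [Real.zero_rpow (by linarith), one_div, Real.inv_rpow (by norm_num),
        Real.rpow_neg (by norm_num)]
      simp
    | succ k ih =>
      rw [Finset.sum_range_succ, mul_add]
      have h := mul_rpow_le_sub_rpow ht (x := (k : ℝ) + 1)
        (by have : (0 : ℝ) ≤ k := k.cast_nonneg
            linarith)
      rw [show (k : ℝ) + 1 - 1 / 2 = k + 1 / 2 by ring] at h
      push_cast at h ⊢
      linarith
  rw [le_div_iff₀ ht, mul_comm]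
  cases N with
  | zero => simp; positivity
  | succ k =>
    have : 0 ≤ ((k : ℝ) + 1 / 2) ^ (-t) := by positivity
    linarith [key k]

theorem sum_primesBelow_neg_log_le {t : ℝ} (ht : 0 < t) (N : ℕ) :
    ∑ p ∈ N.primesBelow, -Real.log (1 - (p : ℝ) ^ (-(1 + t))) ≤
      t * Real.log 2 - Real.log t := by
  let φ : ℕ →* ℝ :=
    { toFun := fun n => (n : ℝ) ^ (-(1 + t))
      map_one' := by simp
      map_mul' := fun a b => by
        push_cast
        exact Real.mul_rpow a.cast_nonneg b.cast_nonneg }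
  have hnn : ∀ n, 0 ≤ φ n := fun n => by
    change 0 ≤ (n : ℝ) ^ (-(1 + t))
    positivity
  have hsum : Summable φ := summable_of_sum_range_le hnn (sum_range_rpow_le ht)
  have h1 := EulerProduct.prod_primesBelow_geometric_eq_tsum_smoothNumbers hsum N
  have h2 : ∏ p ∈ N.primesBelow, (1 - φ p)⁻¹ ≤ 2 ^ t / t := by
    rw [h1]
    refine (hsum.tsum_subtype_le φ _ hnn).trans ?_
    exact Real.tsum_le_of_sum_range_le hnn (sum_range_rpow_le ht)
  have hpos : ∀ p ∈ N.primesBelow, 0 < 1 - φ p := by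
    intro p hp
    have := (Nat.prime_of_mem_primesBelow hp).one_lt
    have : φ p < 1 := Real.rpow_lt_one_of_one_lt_of_neg (by exact_mod_cast this) (by linarith)
    linarith
  calc ∑ p ∈ N.primesBelow, -Real.log (1 - (p : ℝ) ^ (-(1 + t)))
      = ∑ p ∈ N.primesBelow, Real.log ((1 - φ p)⁻¹) :=
        Finset.sum_congr rfl fun p _ => (Real.log_inv _).symm
    _ = Real.log (∏ p ∈ N.primesBelow, (1 - φ p)⁻¹) :=
        (Real.log_prod fun p hp => (inv_pos.2 (hpos p hp)).ne').symm
    _ ≤ Real.log (2 ^ t / t) :=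
        Real.log_le_log (Finset.prod_pos fun p hp => inv_pos.2 (hpos p hp)) h2
    _ = _ := by
      rw [Real.log_div (by positivity) ht.ne', Real.log_rpow (by norm_num)]

theorem sum_vonMangoldt_div_log_rpow_le {t : ℝ} (ht : 0 < t) {q N : ℕ} {F : Finset ℕ}
    (hF : ∀ d ∈ F, d < N ∧ ∀ p, p.Prime → p ∣ d → q ≤ p) :
    ∑ d ∈ F, ArithmeticFunction.vonMangoldt d / Real.log d * (d : ℝ) ^ (-(1 + t)) ≤
      ∑ p ∈ N.primesBelow with q ≤ p, -Real.log (1 - (p : ℝ) ^ (-(1 + t))) := by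
  set w : ℕ → ℝ := fun d => ArithmeticFunction.vonMangoldt d / Real.log d * (d : ℝ) ^ (-(1 + t))
    with hw
  have hw0 : ∀ d, 0 ≤ w d := fun d => by
    have := @ArithmeticFunction.vonMangoldt_nonneg d
    have := Real.log_natCast_nonneg d
    simp only [hw]
    positivity
  set S := N.primesBelow.filter (q ≤ ·)
  have hsub : ∑ d ∈ F, w d ≤
      ∑ d ∈ (S ×ˢ Finset.range N).image (fun x => x.1 ^ (x.2 + 1)), w d := by
    refine (Finset.sum_filter_ne_zero (s := F) (f := w)).symm.le.trans ?_
    apply Finset.sum_le_sum_of_subset_of_nonneg _ fun d _ _ => hw0 d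
    intro d hd
    obtain ⟨hd, hne⟩ := Finset.mem_filter.1 hd
    have hΛ : ArithmeticFunction.vonMangoldt d ≠ 0 := by
      intro h
      simp [hw, h] at hne
    rw [ArithmeticFunction.vonMangoldt_ne_zero_iff, isPrimePow_nat_iff] at hΛ
    obtain ⟨p, k, hp, hk, rfl⟩ := hΛ
    obtain ⟨h1, h2⟩ := hF _ hd
    have hpk : p ≤ p ^ k := Nat.le_self_pow hk.ne' p
    have hkp : k < p ^ k := Nat.lt_pow_self hp.one_lt
    refine Finset.mem_image.2 ⟨(p, k - 1), ?_, by simp [Nat.sub_add_cancel hk]⟩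
    simp only [S, Finset.mem_product, Finset.mem_filter, Finset.mem_range, Nat.mem_primesBelow]
    exact ⟨⟨⟨by omega, hp⟩, h2 p hp (dvd_pow_self p hk.ne')⟩, by omega⟩
  refine hsub.trans ((Finset.sum_image_le_of_nonneg fun d _ => hw0 d).trans ?_)
  rw [Finset.sum_product]
  apply Finset.sum_le_sum
  intro p hp
  have hp' : p.Prime := Nat.prime_of_mem_primesBelow (Finset.mem_filter.1 hp).1
  have hp1 : (1 : ℝ) < p := by exact_mod_cast hp'.one_lt
  have hlt : (p : ℝ) ^ (-(1 + t)) < 1 := Real.rpow_lt_one_of_one_lt_of_neg hp1 (by linarith)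
  have hnn : 0 ≤ (p : ℝ) ^ (-(1 + t)) := by positivity
  have hs := Real.hasSum_pow_div_log_of_abs_lt_one (abs_lt.2 ⟨by linarith, hlt⟩)
  refine le_trans (le_of_eq ?_) (sum_le_hasSum (Finset.range N) (fun i _ => by positivity) hs)
  apply Finset.sum_congr rfl
  intro k _
  have hl : Real.log p ≠ 0 := (Real.log_pos hp1).ne'
  simp only [hw]
  rw [ArithmeticFunction.vonMangoldt_apply_pow k.succ_ne_zero,
    ArithmeticFunction.vonMangoldt_apply_prime hp']
  push_cast
  rw [Real.log_pow, ← Real.rpow_natCast, ← Real.rpow_mul (by positivity),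
    ← Real.rpow_natCast, ← Real.rpow_mul (by positivity), mul_comm (-(1 + t))]
  push_cast
  field_simp

theorem sum_rough_vonMangoldt_div_log_rpow_le {t : ℝ} (ht : 0 < t) {q : ℕ} {F : Finset ℕ}
    (hF : ∀ d ∈ F, ∀ p, p.Prime → p ∣ d → q ≤ p) :
    ∑ d ∈ F, ArithmeticFunction.vonMangoldt d / Real.log d * (d : ℝ) ^ (-(1 + t)) ≤
      ∑ p ∈ q.primesBelow, Real.log (1 - (p : ℝ) ^ (-(1 + t))) +
        (t * Real.log 2 - Real.log t) := by
  set N := max q (F.sup id + 1)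
  have hFN : ∀ d ∈ F, d < N := fun d hd =>
    lt_max_of_lt_right (Nat.lt_succ_of_le (Finset.le_sup (f := id) hd))
  have h1 := sum_vonMangoldt_div_log_rpow_le ht (q := q) (N := N) (F := F)
    fun d hd => ⟨hFN d hd, hF d hd⟩
  have h2 := sum_primesBelow_neg_log_le ht N
  rw [← Finset.sum_filter_add_sum_filter_not N.primesBelow (q ≤ ·)] at h2
  have h3 : N.primesBelow.filter (fun p => ¬ q ≤ p) = q.primesBelow := by
    ext p
    simp only [Finset.mem_filter, Nat.mem_primesBelow, N]
    constructor
    · rintro ⟨⟨_, hp⟩, h⟩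
      exact ⟨by omega, hp⟩
    · rintro ⟨h, hp⟩
      exact ⟨⟨lt_max_of_lt_left h, hp⟩, by omega⟩
  rw [h3, Finset.sum_neg_distrib (s := q.primesBelow)] at h2
  linarith

theorem integral_Ioi_log_mul_exp_neg :
    ∫ t in Set.Ioi (0 : ℝ), Real.log t * Real.exp (-t) = -Real.eulerMascheroniConstant := by
  have h1 := Complex.hasDerivAt_GammaIntegral (s := 1) (by norm_num)
  have h2 : HasDerivAt Complex.GammaIntegral (-(Real.eulerMascheroniConstant : ℂ)) 1 := by
    refine Complex.hasDerivAt_Gamma_one.congr_of_eventuallyEq ?_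
    have : ∀ᶠ s : ℂ in nhds 1, 0 < s.re :=
      Complex.continuous_re.continuousAt.eventually (lt_mem_nhds (by norm_num))
    filter_upwards [this] with s hs using (Complex.Gamma_eq_integral hs).symm
  have h3 := h1.unique h2
  simp only [sub_self, Complex.cpow_zero, one_mul] at h3
  have h4 : ((∫ t in Set.Ioi (0 : ℝ), Real.log t * Real.exp (-t) : ℝ) : ℂ) =
      -(Real.eulerMascheroniConstant : ℂ) := by
    rw [← h3, ← integral_complex_ofReal]
    simp
  exact_mod_cast h4

theorem integrableOn_Ioi_log_mul_exp_neg :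
    MeasureTheory.IntegrableOn (fun t : ℝ => Real.log t * Real.exp (-t)) (Set.Ioi 0) := by
  by_contra h
  have h1 := integral_Ioi_log_mul_exp_neg
  rw [MeasureTheory.integral_undef h] at h1
  have := Real.one_half_lt_eulerMascheroniConstant
  linarith

theorem integrableOn_Ioi_log_mul_exp_neg_mul {L : ℝ} (hL : 0 < L) :
    MeasureTheory.IntegrableOn (fun t : ℝ => Real.log t * Real.exp (-(L * t))) (Set.Ioi 0) := by
  have h := (MeasureTheory.integrableOn_Ioi_comp_mul_left_iff
    (fun t : ℝ => Real.log t * Real.exp (-t)) 0 hL).2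
    (by simpa using integrableOn_Ioi_log_mul_exp_neg)
  refine MeasureTheory.IntegrableOn.congr_fun
    (h.sub ((integrableOn_exp_neg_mul hL).const_mul (Real.log L))) ?_ measurableSet_Ioi
  intro t ht
  simp only [Pi.sub_apply]
  rw [Real.log_mul hL.ne' (ne_of_gt ht)]
  ring

theorem integral_Ioi_log_mul_exp_neg_mul {L : ℝ} (hL : 0 < L) :
    ∫ t in Set.Ioi (0 : ℝ), Real.log t * Real.exp (-(L * t)) =
      (-Real.eulerMascheroniConstant - Real.log L) / L := by
  have h := MeasureTheory.integral_comp_mul_left_Ioi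
    (fun t : ℝ => Real.log t * Real.exp (-t)) 0 hL
  rw [mul_zero, integral_Ioi_log_mul_exp_neg] at h
  have h2 : ∫ t in Set.Ioi (0 : ℝ), Real.log (L * t) * Real.exp (-(L * t)) =
      ∫ t in Set.Ioi (0 : ℝ), (Real.log L * Real.exp (-(L * t)) +
        Real.log t * Real.exp (-(L * t))) := by
    refine MeasureTheory.setIntegral_congr_fun measurableSet_Ioi fun t ht => ?_
    rw [Real.log_mul hL.ne' (ne_of_gt ht), add_mul]
  rw [h2, MeasureTheory.integral_add ((integrableOn_exp_neg_mul hL).const_mul _)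
    (integrableOn_Ioi_log_mul_exp_neg_mul hL), MeasureTheory.integral_const_mul,
    integral_exp_neg_mul hL, smul_eq_mul] at h
  field_simp at h ⊢
  linarith

theorem integral_Ioi_mul_exp_neg_mul {L : ℝ} (hL : 0 < L) :
    ∫ t in Set.Ioi (0 : ℝ), t * Real.exp (-(L * t)) = 1 / L ^ 2 := by
  have h := Real.integral_rpow_mul_exp_neg_mul_Ioi (a := 2) (by norm_num) hL
  rw [Real.Gamma_two] at h
  norm_num at h
  rw [h, one_div]

theorem integrableOn_Ioi_mul_exp_neg_mul {L : ℝ} (hL : 0 < L) :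
    MeasureTheory.IntegrableOn (fun t : ℝ => t * Real.exp (-(L * t))) (Set.Ioi 0) := by
  by_contra h
  have h1 := integral_Ioi_mul_exp_neg_mul hL
  rw [MeasureTheory.integral_undef h] at h1
  have : 0 < 1 / L ^ 2 := by positivity
  linarith

theorem rpow_neg_mul_exp_neg_mul {d : ℕ} (hd : 1 ≤ d) (L t : ℝ) :
    (d : ℝ) ^ (-t) * Real.exp (-(L * t)) = Real.exp (-((L + Real.log d) * t)) := by
  rw [Real.rpow_def_of_pos (by exact_mod_cast hd), ← Real.exp_add]
  congr 1
  ring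

theorem integral_sum_rpow_neg_mul_exp {L : ℝ} (hL : 0 < L) (J : Finset ℕ) (hJ : ∀ d ∈ J, 1 ≤ d)
    (c : ℕ → ℝ) :
    MeasureTheory.IntegrableOn
      (fun t : ℝ => (∑ d ∈ J, c d * (d : ℝ) ^ (-t)) * Real.exp (-(L * t))) (Set.Ioi 0) ∧
    ∫ t in Set.Ioi (0 : ℝ), (∑ d ∈ J, c d * (d : ℝ) ^ (-t)) * Real.exp (-(L * t)) =
      ∑ d ∈ J, c d / (L + Real.log d) := by
  have heq : (fun t : ℝ => (∑ d ∈ J, c d * (d : ℝ) ^ (-t)) * Real.exp (-(L * t))) =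
      fun t => ∑ d ∈ J, c d * Real.exp (-((L + Real.log d) * t)) := by
    funext t
    rw [Finset.sum_mul]
    exact Finset.sum_congr rfl fun d hd => by
      rw [mul_assoc, rpow_neg_mul_exp_neg_mul (hJ d hd)]
  have hpos : ∀ d : ℕ, 0 < L + Real.log d := fun d =>
    add_pos_of_pos_of_nonneg hL (Real.log_natCast_nonneg d)
  have hi : ∀ d ∈ J, MeasureTheory.IntegrableOn
      (fun t : ℝ => c d * Real.exp (-((L + Real.log d) * t))) (Set.Ioi 0) :=
    fun d _ => (integrableOn_exp_neg_mul (hpos d)).const_mul _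
  rw [heq]
  refine ⟨MeasureTheory.integrable_finsetSum J hi, ?_⟩
  rw [MeasureTheory.integral_finsetSum J hi]
  refine Finset.sum_congr rfl fun d _ => ?_
  rw [MeasureTheory.integral_const_mul, integral_exp_neg_mul (hpos d), mul_one_div]

theorem sum_rough_vonMangoldt_le_of_forall_rpow {q : ℕ} {L C : ℝ} (hL : 0 < L) {J : Finset ℕ}
    (hJ : ∀ d ∈ J, 1 ≤ d) {c : ℕ → ℝ}
    (hc : ∀ t : ℝ, 0 < t → ∑ p ∈ q.primesBelow, Real.log (1 - (p : ℝ) ^ (-(1 + t))) ≤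
      C + ∑ d ∈ J, c d * (d : ℝ) ^ (-t))
    {F : Finset ℕ} (hF : ∀ d ∈ F, 1 < d ∧ ∀ p, p.Prime → p ∣ d → q ≤ p) :
    ∑ d ∈ F, ArithmeticFunction.vonMangoldt d / (d * Real.log d * (L + Real.log d)) ≤
      (Real.eulerMascheroniConstant + Real.log L + Real.log 2 / L + C) / L +
        ∑ d ∈ J, c d / (L + Real.log d) := by
  obtain ⟨hi1, he1⟩ := integral_sum_rpow_neg_mul_exp hL F (fun d hd => (hF d hd).1.le)
    (fun d => ArithmeticFunction.vonMangoldt d / (d * Real.log d))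
  obtain ⟨hi2, he2⟩ := integral_sum_rpow_neg_mul_exp hL J hJ c
  have hi3 := (integrableOn_Ioi_mul_exp_neg_mul hL).const_mul (Real.log 2)
  have hi4 := integrableOn_Ioi_log_mul_exp_neg_mul hL
  have hi5 := (integrableOn_exp_neg_mul hL).const_mul C
  have hmono := MeasureTheory.setIntegral_mono_on hi1 (((hi5.add hi2).add hi3).sub hi4)
    measurableSet_Ioi (fun t ht => by
      have ht : 0 < t := ht
      have h1 := sum_rough_vonMangoldt_div_log_rpow_le ht (q := q) (F := F)
        fun d hd => (hF d hd).2
      have h2 := h1.trans (add_le_add_left (hc t ht) _)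
      have h3 := mul_le_mul_of_nonneg_right h2 (Real.exp_pos (-(L * t))).le
      simp only [Pi.sub_apply, Pi.add_apply]
      refine le_trans (le_of_eq ?_) (h3.trans (le_of_eq ?_))
      · congr 1
        refine Finset.sum_congr rfl fun d hd => ?_
        have hd0 : (0 : ℝ) < d := by exact_mod_cast (zero_lt_one.trans (hF d hd).1)
        rw [neg_add, Real.rpow_add hd0, Real.rpow_neg_one]
        field_simp
      · ring)
  have e1 := MeasureTheory.integral_sub ((hi5.add hi2).add hi3) hi4
  have e2 := MeasureTheory.integral_add (hi5.add hi2) hi3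
  have e3 := MeasureTheory.integral_add hi5 hi2
  rw [he1] at hmono
  simp only [Pi.sub_apply, Pi.add_apply] at hmono e1 e2 e3
  rw [e1, e2, e3, he2, MeasureTheory.integral_const_mul, MeasureTheory.integral_const_mul,
    integral_exp_neg_mul hL, integral_Ioi_mul_exp_neg_mul hL,
    integral_Ioi_log_mul_exp_neg_mul hL] at hmono
  simp only [div_div] at hmono
  refine hmono.trans (le_of_eq ?_)
  field_simp
  ring

section BinaryLogBound

open Finset

/-- A step function bounding the binary logarithm of `p` from above for `p ≤ 128`. -/
noncomputable def binaryLogBound (p : ℕ) : ℝ :=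
  if p ≤ 2 then 1 else if p ≤ 3 then 8 / 5 else if p ≤ 5 then 7 / 3 else if p ≤ 7 then 45 / 16
  else if p ≤ 11 then 7 / 2 else if p ≤ 13 then 15 / 4 else if p ≤ 32 then 5
  else if p ≤ 64 then 6 else 7

theorem log_le_div_mul_log_two {p m a b : ℕ} (hp : 0 < p) (hpm : p ≤ m) (ha : 0 < a)
    (h : m ^ a ≤ 2 ^ b) : Real.log p ≤ (b : ℝ) / a * Real.log 2 := by
  have h1 : (p : ℝ) ^ a ≤ 2 ^ b := by
    exact_mod_cast (Nat.pow_le_pow_left hpm a).trans h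
  have h2 := Real.log_le_log (by positivity) h1
  rw [Real.log_pow, Real.log_pow] at h2
  rw [div_mul_eq_mul_div, le_div_iff₀ (by exact_mod_cast ha)]
  linarith

theorem div_mul_log_two_le_log {p a b : ℕ} (ha : 0 < a) (h : 2 ^ b ≤ p ^ a) :
    (b : ℝ) / a * Real.log 2 ≤ Real.log p := by
  have h1 : (2 : ℝ) ^ b ≤ (p : ℝ) ^ a := by exact_mod_cast h
  have h2 := Real.log_le_log (by positivity) h1
  rw [Real.log_pow, Real.log_pow] at h2
  rw [div_mul_eq_mul_div, div_le_iff₀ (by exact_mod_cast ha)]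
  linarith

theorem log_le_binaryLogBound_mul {p : ℕ} (hp : 0 < p) (hp' : p ≤ 128) :
    Real.log p ≤ binaryLogBound p * Real.log 2 := by
  unfold binaryLogBound
  split_ifs with h1 h2 h3 h4 h5 h6 h7 h8
  · simpa using log_le_div_mul_log_two (a := 1) (b := 1) hp h1 (by norm_num) (by norm_num)
  · simpa using log_le_div_mul_log_two (a := 5) (b := 8) hp h2 (by norm_num) (by norm_num)
  · simpa using log_le_div_mul_log_two (a := 3) (b := 7) hp h3 (by norm_num) (by norm_num)
  · simpa using log_le_div_mul_log_two (a := 16) (b := 45) hp h4 (by norm_num) (by norm_num)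
  · simpa using log_le_div_mul_log_two (a := 2) (b := 7) hp h5 (by norm_num) (by norm_num)
  · simpa using log_le_div_mul_log_two (a := 4) (b := 15) hp h6 (by norm_num) (by norm_num)
  · simpa using log_le_div_mul_log_two (a := 1) (b := 5) hp h7 (by norm_num) (by norm_num)
  · simpa using log_le_div_mul_log_two (a := 1) (b := 6) hp h8 (by norm_num) (by norm_num)
  · simpa using log_le_div_mul_log_two (a := 1) (b := 7) hp hp' (by norm_num) (by norm_num)

theorem primesBelow_128 : Nat.primesBelow 128 = {2, 3, 5, 7, 11, 13, 17, 19, 23, 29, 31, 37, 41,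
    43, 47, 53, 59, 61, 67, 71, 73, 79, 83, 89, 97, 101, 103, 107, 109, 113, 127} := by
  decide +kernel

theorem primesBelow_mono {m n : ℕ} (h : m ≤ n) : m.primesBelow ⊆ n.primesBelow := fun p hp => by
  rw [Nat.mem_primesBelow] at hp ⊢
  exact ⟨hp.1.trans_le h, hp.2⟩

theorem sum_primesBelow_mono {w : ℕ → ℝ} {m n : ℕ} (h : m ≤ n)
    (hw : ∀ p ∈ n.primesBelow, 0 ≤ w p) : ∑ p ∈ m.primesBelow, w p ≤ ∑ p ∈ n.primesBelow, w p :=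
  sum_le_sum_of_subset_of_nonneg (primesBelow_mono h) fun p hp _ => hw p hp

theorem one_lt_cast_of_mem_primesBelow {n p : ℕ} (hp : p ∈ n.primesBelow) : (1 : ℝ) < p := by
  exact_mod_cast (Nat.prime_of_mem_primesBelow hp).one_lt

theorem sum_log_div_pred_le_of_lt {N : ℕ} (hN : 0 < N) (hN' : N < 128) :
    ∑ p ∈ (N + 1).primesBelow, Real.log p / (p - 1) ≤ Real.log N + 0.79 := by
  have l0 := Real.log_two_gt_d9
  have l1 := Real.log_two_lt_d9
  have key : ∀ k m : ℕ, 2 ^ k ≤ N → N < m → m ≤ 128 →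
      ∑ p ∈ m.primesBelow, binaryLogBound p / (p - 1) ≤ k + 1.13 →
      ∑ p ∈ (N + 1).primesBelow, Real.log p / (p - 1) ≤ Real.log N + 0.79 := by
    intro k m hk hm hm' h
    have h1 : ∑ p ∈ m.primesBelow, Real.log p / (p - 1) ≤
        ∑ p ∈ m.primesBelow, binaryLogBound p / (p - 1) * Real.log 2 := by
      apply sum_le_sum
      intro p hp
      have := one_lt_cast_of_mem_primesBelow hp
      have hlt := Nat.lt_of_mem_primesBelow hp
      rw [div_mul_eq_mul_div]
      exact div_le_div_of_nonneg_right (log_le_binaryLogBound_mul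
        (Nat.prime_of_mem_primesBelow hp).pos (by omega)) (by linarith)
    have h2 : ∑ p ∈ (N + 1).primesBelow, Real.log p / (p - 1) ≤
        ∑ p ∈ m.primesBelow, Real.log p / (p - 1) :=
      sum_primesBelow_mono hm fun p hp => by
        have := one_lt_cast_of_mem_primesBelow hp
        exact div_nonneg (Real.log_natCast_nonneg p) (by linarith)
    rw [← sum_mul] at h1
    have h3 := div_mul_log_two_le_log (p := N) (a := 1) (b := k) one_pos (by simpa using hk)
    rw [Nat.cast_one, div_one] at h3
    have h4 := mul_le_mul_of_nonneg_right h (show 0 ≤ Real.log 2 by linarith)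
    linarith
  rcases lt_or_ge N 2 with h | h
  · refine key 0 2 (by omega) (by omega) (by omega) ?_
    rw [show Nat.primesBelow 2 = ∅ by decide +kernel]
    norm_num
  rcases lt_or_ge N 4 with h | h
  · refine key 1 4 (by omega) (by omega) (by omega) ?_
    rw [show Nat.primesBelow 4 = {2, 3} by decide +kernel]
    norm_num [binaryLogBound]
  rcases lt_or_ge N 8 with h | h
  · refine key 2 8 (by omega) (by omega) (by omega) ?_
    rw [show Nat.primesBelow 8 = {2, 3, 5, 7} by decide +kernel]
    norm_num [binaryLogBound]
  rcases lt_or_ge N 16 with h | h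
  · refine key 3 16 (by omega) (by omega) (by omega) ?_
    rw [show Nat.primesBelow 16 = {2, 3, 5, 7, 11, 13} by decide +kernel]
    norm_num [binaryLogBound]
  rcases lt_or_ge N 32 with h | h
  · refine key 4 32 (by omega) (by omega) (by omega) ?_
    rw [show Nat.primesBelow 32 = {2, 3, 5, 7, 11, 13, 17, 19, 23, 29, 31} by decide +kernel]
    norm_num [binaryLogBound]
  rcases lt_or_ge N 64 with h | h
  · refine key 5 64 (by omega) (by omega) (by omega) ?_
    rw [show Nat.primesBelow 64 = {2, 3, 5, 7, 11, 13, 17, 19, 23, 29, 31, 37, 41, 43, 47, 53,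
      59, 61} by decide +kernel]
    norm_num [binaryLogBound]
  · refine key 6 128 (by omega) (by omega) (by omega) ?_
    rw [primesBelow_128]
    norm_num [binaryLogBound]

theorem sum_primesBelow_128_log_div_le :
    ∑ p ∈ Nat.primesBelow 128 with 5 ≤ p, Real.log p / (p * (p - 1)) ≤ 0.2275 := by
  have l0 := Real.log_two_gt_d9
  have l1 := Real.log_two_lt_d9
  have h1 : ∑ p ∈ Nat.primesBelow 128 with 5 ≤ p, Real.log p / (p * (p - 1)) ≤
      ∑ p ∈ Nat.primesBelow 128 with 5 ≤ p, binaryLogBound p / (p * (p - 1)) * Real.log 2 := by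
    apply sum_le_sum
    intro p hp
    have hp := (mem_filter.1 hp).1
    have := one_lt_cast_of_mem_primesBelow hp
    have hlt := Nat.lt_of_mem_primesBelow hp
    rw [div_mul_eq_mul_div]
    exact div_le_div_of_nonneg_right (log_le_binaryLogBound_mul
      (Nat.prime_of_mem_primesBelow hp).pos (by omega))
      (mul_nonneg (by linarith) (by linarith))
  rw [← sum_mul] at h1
  have h2 : ∑ p ∈ Nat.primesBelow 128 with 5 ≤ p, binaryLogBound p / (p * (p - 1)) ≤ 0.328 := by
    rw [primesBelow_128, sum_filter]
    norm_num [binaryLogBound]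
  have h3 := mul_le_mul_of_nonneg_right h2 (show 0 ≤ Real.log 2 by linarith)
  linarith

theorem log_two_div_add_sum_lt_one_of_le {q m : ℕ} {Λ : ℝ} (hΛ : 0 < Λ) (hqm : q ≤ m)
    (hm : m ≤ 128) (hq : Λ * Real.log 2 ≤ Real.log q)
    (h : 1 / Λ + ∑ p ∈ m.primesBelow, binaryLogBound p / ((p - 1) * (Λ + binaryLogBound p)) < 1) :
    Real.log 2 / Real.log q +
      ∑ p ∈ q.primesBelow, Real.log p / ((p - 1) * (Real.log q + Real.log p)) < 1 := by
  have l0 : 0 < Real.log 2 := Real.log_pos one_lt_two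
  have hL : 0 < Real.log q := lt_of_lt_of_le (by positivity) hq
  refine lt_of_le_of_lt (add_le_add ?_ ?_) h
  · rw [div_le_div_iff₀ hL hΛ]
    linarith
  · have hnn : ∀ p ∈ m.primesBelow,
        0 ≤ Real.log p / ((p - 1) * (Real.log q + Real.log p)) := by
      intro p hp
      have := one_lt_cast_of_mem_primesBelow hp
      have := Real.log_natCast_nonneg p
      exact div_nonneg this (mul_nonneg (by linarith) (by linarith))
    refine (sum_primesBelow_mono hqm hnn).trans (sum_le_sum ?_)
    intro p hp
    have hp1 := one_lt_cast_of_mem_primesBelow hp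
    have hp0 := Real.log_natCast_nonneg p
    have hlt := Nat.lt_of_mem_primesBelow hp
    have hu := log_le_binaryLogBound_mul (Nat.prime_of_mem_primesBelow hp).pos
      (show p ≤ 128 by omega)
    have hu0 : 0 ≤ binaryLogBound p := by
      by_contra! hc
      nlinarith
    have hp2 : (0 : ℝ) < p - 1 := by linarith
    rw [div_le_div_iff₀ (by positivity) (by positivity)]
    have : Real.log p * Λ ≤ binaryLogBound p * Real.log q := by
      calc Real.log p * Λ ≤ binaryLogBound p * Real.log 2 * Λ := by gcongr
        _ = binaryLogBound p * (Λ * Real.log 2) := by ring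
        _ ≤ _ := by gcongr
    nlinarith

theorem log_two_div_add_sum_lt_one_of_lt {q : ℕ} (hq : q.Prime) (hq5 : 5 ≤ q) (hq' : q ≤ 128) :
    Real.log 2 / Real.log q +
      ∑ p ∈ q.primesBelow, Real.log p / ((p - 1) * (Real.log q + Real.log p)) < 1 := by
  have l0 : 0 < Real.log 2 := Real.log_pos one_lt_two
  have key : ∀ {r m a b : ℕ}, r ≤ q → q ≤ m → m ≤ 128 → 0 < a → 0 < b → 2 ^ b ≤ r ^ a →
      1 / ((b : ℝ) / a) + ∑ p ∈ m.primesBelow,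
        binaryLogBound p / ((p - 1) * ((b : ℝ) / a + binaryLogBound p)) < 1 →
      Real.log 2 / Real.log q +
        ∑ p ∈ q.primesBelow, Real.log p / ((p - 1) * (Real.log q + Real.log p)) < 1 :=
    fun hr hm hm' ha hb h hlt => log_two_div_add_sum_lt_one_of_le (by positivity) hm hm'
      (div_mul_log_two_le_log ha (h.trans (Nat.pow_le_pow_left hr _))) hlt
  rcases lt_or_ge q 11 with h | h
  · interval_cases q
    · refine key (r := 5) (m := 5) (a := 25) (b := 58) (by norm_num) (by norm_num) (by norm_num)
        (by norm_num) (by norm_num) (by norm_num) ?_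
      rw [show Nat.primesBelow 5 = {2, 3} by decide +kernel]
      norm_num [binaryLogBound]
    · exact absurd hq (by norm_num)
    · refine key (r := 7) (m := 7) (a := 5) (b := 14) (by norm_num) (by norm_num) (by norm_num)
        (by norm_num) (by norm_num) (by norm_num) ?_
      rw [show Nat.primesBelow 7 = {2, 3, 5} by decide +kernel]
      norm_num [binaryLogBound]
    · exact absurd hq (by norm_num)
    · exact absurd hq (by norm_num)
    · exact absurd hq (by norm_num)
  rcases le_or_gt q 17 with h' | h'
  · refine key (m := 17) (a := 5) (b := 17) h h' (by norm_num) (by norm_num) (by norm_num)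
      (by norm_num) ?_
    rw [show Nat.primesBelow 17 = {2, 3, 5, 7, 11, 13} by decide +kernel]
    norm_num [binaryLogBound]
  rcases le_or_gt q 31 with h | h
  · refine key (m := 31) (a := 1) (b := 4) h'.le h (by norm_num) (by norm_num) (by norm_num)
      (by norm_num) ?_
    rw [show Nat.primesBelow 31 = {2, 3, 5, 7, 11, 13, 17, 19, 23, 29} by decide +kernel]
    norm_num [binaryLogBound]
  rcases le_or_gt q 47 with h' | h'
  · refine key (m := 47) (a := 10) (b := 49) h.le h' (by norm_num) (by norm_num) (by norm_num)
      (by norm_num) ?_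
    rw [show Nat.primesBelow 47 = {2, 3, 5, 7, 11, 13, 17, 19, 23, 29, 31, 37, 41, 43}
      by decide +kernel]
    norm_num [binaryLogBound]
  · refine key (m := 128) (a := 2) (b := 11) h'.le hq' (by norm_num) (by norm_num) (by norm_num)
      (by norm_num) ?_
    rw [primesBelow_128]
    norm_num [binaryLogBound]

end BinaryLogBound

section SumLogDivPred

open Finset

theorem log_factorial_le {n : ℕ} (hn : 1 ≤ n) :
    Real.log (n.factorial : ℝ) ≤ n * Real.log n - n + 1 + Real.log n := by
  induction n, hn using Nat.le_induction with
  | base => simp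
  | succ n hn ih =>
    have hn0 : (0 : ℝ) < n := by exact_mod_cast hn
    have h1 := Real.one_sub_inv_le_log_of_pos (x := ((n : ℝ) + 1) / n) (by positivity)
    rw [Real.log_div (by positivity) hn0.ne'] at h1
    have h2 : (1 : ℝ) ≤ (n + 1) * (Real.log (n + 1) - Real.log n) := by
      calc (1 : ℝ) = (n + 1) * (1 - (((n : ℝ) + 1) / n)⁻¹) := by
            field_simp
            ring
        _ ≤ _ := by gcongr
    rw [Nat.factorial_succ, Nat.cast_mul, Real.log_mul (by positivity) (by positivity)]
    push_cast
    linarith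

theorem sum_mul_log_primesBelow_le_log_factorial (N : ℕ) :
    ∑ p ∈ (N + 1).primesBelow, (padicValNat p N.factorial : ℝ) * Real.log p ≤
      Real.log (N.factorial : ℝ) := by
  rw [Real.log_nat_eq_sum_factorization, Finsupp.sum]
  refine le_of_eq (sum_subset_zero_on_sdiff ?_ ?_ ?_).symm
  · intro p hp
    rw [Nat.support_factorization, Nat.mem_primeFactors] at hp
    exact Nat.mem_primesBelow.2 ⟨Nat.lt_succ_of_le ((hp.1.dvd_factorial).1 hp.2.1), hp.1⟩
  · intro p hp
    obtain ⟨h1, h2⟩ := mem_sdiff.1 hp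
    rw [← Nat.factorization_def _ (Nat.prime_of_mem_primesBelow h1),
      Finsupp.notMem_support_iff.1 h2]
    simp
  · intro p hp
    rw [Nat.support_factorization, Nat.mem_primeFactors] at hp
    rw [Nat.factorization_def _ hp.1]

theorem mul_log_div_pred_le {p N : ℕ} (hp : p.Prime) (hN : N ≠ 0) :
    N * (Real.log p / (p - 1)) ≤
      padicValNat p N.factorial * Real.log p + (Real.log N + Real.log p) := by
  have := Fact.mk hp
  have hp1 : (1 : ℝ) < p := by exact_mod_cast hp.one_lt
  have hlp : 0 < Real.log p := Real.log_pos hp1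
  have h1 := sub_one_mul_padicValNat_factorial (p := p) N
  have h2 : (p.digits N).sum ≤ (Nat.log p N + 1) * (p - 1) := by
    rw [← Nat.length_digits p N hp.one_lt hN, ← smul_eq_mul]
    exact List.sum_le_card_nsmul _ _ fun d hd => Nat.le_sub_one_of_lt
      (Nat.digits_lt_base hp.one_lt hd)
  have h3 : N ≤ (p - 1) * padicValNat p N.factorial + (Nat.log p N + 1) * (p - 1) := by omega
  have h4 : (N : ℝ) ≤ ((p : ℝ) - 1) * padicValNat p N.factorial +
      (Nat.log p N + 1) * ((p : ℝ) - 1) := by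
    have h5 : ((N : ℕ) : ℝ) ≤
        (((p - 1) * padicValNat p N.factorial + (Nat.log p N + 1) * (p - 1) : ℕ) : ℝ) :=
      Nat.cast_le.2 h3
    push_cast [Nat.cast_sub hp.one_le] at h5
    exact h5
  have h6 : Nat.log p N * Real.log p ≤ Real.log N := by
    rw [← Real.log_pow]
    apply Real.log_le_log (by positivity)
    exact_mod_cast Nat.pow_log_le_self p hN
  have hp2 : (0 : ℝ) < p - 1 := by linarith
  rw [← mul_div_assoc, div_le_iff₀ hp2]
  have h7 := mul_le_mul_of_nonneg_right h4 hlp.le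
  have h8 := mul_le_mul_of_nonneg_right h6 hp2.le
  nlinarith

theorem mul_log_div_pred_le' {p N : ℕ} (hp : p.Prime) :
    N * (Real.log p / (p - 1)) ≤
      padicValNat p N.factorial * Real.log p +
        (Real.log p + N * (Real.log p / (p * (p - 1)))) := by
  have := Fact.mk hp
  have hp1 : (1 : ℝ) < p := by exact_mod_cast hp.one_lt
  have hlp : 0 < Real.log p := Real.log_pos hp1
  have h1 : N / p ≤ padicValNat p N.factorial := by
    rw [padicValNat_factorial (b := Nat.log p N + 2) (by omega)]
    have := single_le_sum (s := Ico 1 (Nat.log p N + 2)) (f := fun i => N / p ^ i)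
      (fun i _ => Nat.zero_le _) (mem_Ico.2 ⟨le_refl 1, by omega⟩)
    simpa using this
  have h2 : (N : ℝ) ≤ p * (padicValNat p N.factorial + 1) := by
    have h3 : N < (N / p + 1) * p := Nat.lt_div_mul_add hp.pos |>.trans_eq (by ring)
    have h4 : N ≤ p * (padicValNat p N.factorial + 1) := by nlinarith
    exact_mod_cast h4
  have hp2 : (0 : ℝ) < p - 1 := by linarith
  have h5 : (N : ℝ) * (Real.log p / (p - 1)) =
      N / p * Real.log p + N * (Real.log p / (p * (p - 1))) := by
    field_simp
    ring
  have h6 : (N : ℝ) / p ≤ padicValNat p N.factorial + 1 := by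
    rw [div_le_iff₀ (by linarith)]
    linarith
  rw [h5]
  nlinarith

theorem sum_primesBelow_log_le (N : ℕ) :
    ∑ p ∈ (N + 1).primesBelow, Real.log p ≤ Real.log 4 * N := by
  have h := Chebyshev.theta_le_log4_mul_x (x := N) N.cast_nonneg
  rw [Chebyshev.theta, Nat.floor_natCast] at h
  refine le_trans (le_of_eq (sum_congr ?_ fun _ _ => rfl)) h
  ext p
  simp only [Nat.mem_primesBelow, mem_filter, mem_Ioc]
  constructor
  · rintro ⟨h, hp⟩
    exact ⟨⟨hp.pos, by omega⟩, hp⟩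
  · rintro ⟨h, hp⟩
    exact ⟨by omega, hp⟩

theorem sum_Ico_log_div_le {N : ℕ} (hN : 128 ≤ N) :
    ∑ n ∈ Ico 128 N, Real.log n / (n * (n - 1)) ≤
      (Real.log 127 + 1.01) / 127 - (Real.log (N - 1 : ℝ) + 1.01) / (N - 1) := by
  induction N, hN using Nat.le_induction with
  | base => norm_num
  | succ n hn ih =>
    rw [sum_Ico_succ_top hn]
    have hn' : (128 : ℝ) ≤ n := by exact_mod_cast hn
    have h0 : (0 : ℝ) < n - 1 := by linarith
    have h1 := Real.log_le_sub_one_of_pos (x := (n : ℝ) / (n - 1)) (by positivity)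
    rw [Real.log_div (by positivity) h0.ne'] at h1
    have h2 : (n : ℝ) / (n - 1) - 1 = 1 / (n - 1) := by
      field_simp
      ring
    rw [h2] at h1
    have h3 : (n : ℝ) * (Real.log n - Real.log (n - 1 : ℝ)) ≤ 1.01 := by
      calc (n : ℝ) * (Real.log n - Real.log (n - 1 : ℝ)) ≤ n * (1 / (n - 1)) := by gcongr
        _ ≤ 1.01 := by
          rw [mul_one_div, div_le_iff₀ h0]
          linarith
    have h4 : Real.log n / (n * (n - 1)) ≤
        (Real.log (n - 1 : ℝ) + 1.01) / (n - 1) - (Real.log n + 1.01) / n := by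
      rw [div_sub_div _ _ h0.ne' (by positivity), mul_comm (n : ℝ)]
      apply div_le_div_of_nonneg_right _ (by positivity)
      nlinarith
    push_cast
    rw [add_sub_cancel_right]
    linarith

theorem sum_log_div_mul_pred_le {N : ℕ} (hN : 128 ≤ N) :
    ∑ p ∈ N.primesBelow with 5 ≤ p, Real.log p / (p * (p - 1)) ≤ 0.2737 := by
  have h1 : N.primesBelow.filter (5 ≤ ·) ⊆
      (Nat.primesBelow 128).filter (5 ≤ ·) ∪ Ico 128 N := by
    intro p hp
    simp only [mem_filter, Nat.mem_primesBelow, mem_union, mem_Ico] at hp ⊢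
    rcases lt_or_ge p 128 with h | h
    · exact Or.inl ⟨⟨h, hp.1.2⟩, hp.2⟩
    · exact Or.inr ⟨h, hp.1.1⟩
  have hnn : ∀ p : ℕ, 5 ≤ p → 0 ≤ Real.log p / (p * (p - 1)) := by
    intro p hp
    have : (5 : ℝ) ≤ p := by exact_mod_cast hp
    have := Real.log_natCast_nonneg p
    exact div_nonneg this (mul_nonneg (by linarith) (by linarith))
  have hnn' : ∀ p ∈ (Nat.primesBelow 128).filter (5 ≤ ·) ∪ Ico 128 N,
      0 ≤ Real.log p / (p * (p - 1)) := by
    intro p hp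
    simp only [mem_filter, mem_union, mem_Ico] at hp
    exact hnn p (by omega)
  have h2 := sum_le_sum_of_subset_of_nonneg h1 fun p hp _ => hnn' p hp
  rw [sum_union (disjoint_left.2 fun p hp hp' => by
    simp only [mem_filter, Nat.mem_primesBelow, mem_Ico] at hp hp'
    omega)] at h2
  have h3 := sum_Ico_log_div_le hN
  have h4 : (0 : ℝ) ≤ (Real.log (N - 1 : ℝ) + 1.01) / (N - 1) := by
    have : (128 : ℝ) ≤ N := by exact_mod_cast hN
    have := Real.log_nonneg (x := (N : ℝ) - 1) (by linarith)
    exact div_nonneg (by linarith) (by linarith)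
  have h5 := log_le_div_mul_log_two (p := 127) (m := 128) (a := 1) (b := 7) (by norm_num)
    (by norm_num) (by norm_num) (by norm_num)
  have l1 := Real.log_two_lt_d9
  push_cast at h5
  linarith [sum_primesBelow_128_log_div_le]

theorem sum_log_div_pred_le_of_ge {N : ℕ} (hN : 128 ≤ N) :
    ∑ p ∈ (N + 1).primesBelow, Real.log p / (p - 1) ≤ Real.log N + 0.79 := by
  have hN0 : (128 : ℝ) ≤ N := by exact_mod_cast hN
  have hNpos : (0 : ℝ) < N := by linarith
  set S := (N + 1).primesBelow with hS
  have hp : ∀ p ∈ S, p.Prime := fun p hp => Nat.prime_of_mem_primesBelow hp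
  have hsplit : S.filter (fun p => ¬ 5 ≤ p) = {2, 3} := by
    ext p
    simp only [hS, mem_filter, Nat.mem_primesBelow, mem_insert, mem_singleton]
    constructor
    · rintro ⟨⟨_, hp⟩, h⟩
      interval_cases p <;> revert hp <;> norm_num
    · rintro (rfl | rfl) <;> exact ⟨⟨by omega, by norm_num⟩, by omega⟩
  have key : ∑ p ∈ S, N * (Real.log p / (p - 1)) ≤
      ∑ p ∈ S, (padicValNat p N.factorial : ℝ) * Real.log p + ∑ p ∈ S, Real.log p +
        N * ∑ p ∈ S with 5 ≤ p, Real.log p / (p * (p - 1)) + 2 * Real.log N := by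
    rw [← sum_filter_add_sum_filter_not S (5 ≤ ·),
      ← sum_filter_add_sum_filter_not S (5 ≤ ·) (fun p => (padicValNat p _ : ℝ) * _),
      ← sum_filter_add_sum_filter_not S (5 ≤ ·) (fun p => Real.log p), hsplit]
    have h1 : ∑ p ∈ S with 5 ≤ p, N * (Real.log p / (p - 1)) ≤
        ∑ p ∈ S with 5 ≤ p, (padicValNat p N.factorial * Real.log p +
          (Real.log p + N * (Real.log p / (p * (p - 1))))) :=
      sum_le_sum fun p h => mul_log_div_pred_le' (hp p (mem_filter.1 h).1)
    rw [sum_add_distrib, sum_add_distrib, ← mul_sum, ← mul_sum] at h1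
    rw [← mul_sum]
    have h2 := mul_log_div_pred_le (N := N) Nat.prime_two (by omega)
    have h3 := mul_log_div_pred_le (N := N) Nat.prime_three (by omega)
    simp only [sum_pair (show (2 : ℕ) ≠ 3 by norm_num)]
    linarith
  rw [← mul_sum] at key
  have h1 := sum_mul_log_primesBelow_le_log_factorial N
  have h2 := log_factorial_le (n := N) (by omega)
  have h3 := sum_primesBelow_log_le N
  have h4 := sum_log_div_mul_pred_le (N := N + 1) (by omega)
  have l0 := Real.log_two_gt_d9
  have l1 := Real.log_two_lt_d9
  have h5 : Real.log 4 = 2 * Real.log 2 := by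
    rw [show (4 : ℝ) = 2 ^ 2 by norm_num, Real.log_pow]
    norm_num
  have h6 : Real.log N ≤ 7 * Real.log 2 + (N / 128 - 1) := by
    have h := Real.log_le_sub_one_of_pos (x := (N : ℝ) / 128) (by positivity)
    rw [Real.log_div hNpos.ne' (by norm_num), show (128 : ℝ) = 2 ^ 7 by norm_num,
      Real.log_pow] at h
    norm_num at h ⊢
    linarith
  rw [h5] at h3
  have h7 := mul_le_mul_of_nonneg_left h4 hNpos.le
  have h8 : Real.log 2 * N ≤ 0.6931471808 * N := by gcongr
  rw [← mul_le_mul_iff_right₀ hNpos]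
  linarith

theorem sum_log_div_pred_le {N : ℕ} (hN : 0 < N) :
    ∑ p ∈ (N + 1).primesBelow, Real.log p / (p - 1) ≤ Real.log N + 0.79 := by
  rcases lt_or_ge N 128 with h | h
  · exact sum_log_div_pred_le_of_lt hN h
  · exact sum_log_div_pred_le_of_ge h

end SumLogDivPred

section RoughStart

open Finset

theorem sum_primesBelow_succ (w : ℕ → ℝ) (n : ℕ) :
    ∑ p ∈ (n + 1).primesBelow, w p = ∑ p ∈ n.primesBelow, w p + if n.Prime then w n else 0 := by
  simp only [Nat.primesBelow, sum_filter, sum_range_succ]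

theorem sum_log_div_mul_add_log_le {L : ℝ} (hL : 0 < L) {n : ℕ} (hn : 1 ≤ n) :
    ∑ p ∈ (n + 1).primesBelow, Real.log p / ((p - 1) * (L + Real.log p)) ≤
      0.79 / L + Real.log (L + Real.log n) - Real.log L -
        (Real.log n + 0.79 - ∑ p ∈ (n + 1).primesBelow, Real.log p / (p - 1)) /
          (L + Real.log n) := by
  induction n, hn using Nat.le_induction with
  | base =>
    rw [show Nat.primesBelow (1 + 1) = ∅ by decide +kernel]
    simp
  | succ n hn ih =>
    rw [sum_primesBelow_succ _ (n + 1), sum_primesBelow_succ _ (n + 1)]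
    have hT := sum_log_div_pred_le (N := n) hn
    set T := ∑ p ∈ (n + 1).primesBelow, Real.log p / (p - 1)
    have hn0 : (0 : ℝ) < n := by exact_mod_cast hn
    have hv := Real.log_natCast_nonneg n
    have hvv : Real.log n ≤ Real.log (n + 1 : ℕ) := Real.log_le_log hn0 (by push_cast; linarith)
    set v := Real.log n
    set v' := Real.log (n + 1 : ℕ)
    have hy : 0 < L + v := by linarith
    have hy' : 0 < L + v' := by linarith
    have h1 := Real.one_sub_inv_le_log_of_pos (x := (L + v') / (L + v)) (by positivity)
    rw [Real.log_div hy'.ne' hy.ne', inv_div] at h1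
    have hterm : (if (n + 1).Prime then
        Real.log (n + 1 : ℕ) / (((n + 1 : ℕ) : ℝ) - 1) / (L + v') else 0) =
        (if (n + 1).Prime then v' / ((((n + 1 : ℕ) : ℝ) - 1) * (L + v')) else 0) := by
      split_ifs
      · rw [div_div]
      · rfl
    have hterm' : (if (n + 1).Prime then v' / ((((n + 1 : ℕ) : ℝ) - 1) * (L + v')) else 0) =
        (if (n + 1).Prime then v' / (((n + 1 : ℕ) : ℝ) - 1) else 0) / (L + v') := by
      split_ifs
      · rw [div_div]
      · rw [zero_div]
    rw [hterm']
    set a := if (n + 1).Prime then v' / (((n + 1 : ℕ) : ℝ) - 1) else 0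
    have h2 : (v + 0.79 - T) / (L + v') ≤ (v + 0.79 - T) / (L + v) := by
      apply div_le_div_of_nonneg_left _ hy (by linarith)
      linarith
    have h3 : (v' + 0.79 - (T + a)) / (L + v') =
        (v + 0.79 - T) / (L + v') + (1 - (L + v) / (L + v')) - a / (L + v') := by
      field_simp
      ring
    rw [h3]
    linarith

theorem log_two_div_add_sum_lt_one {q : ℕ} (hq : q.Prime) (hq5 : 5 ≤ q) :
    Real.log 2 / Real.log q +
      ∑ p ∈ q.primesBelow, Real.log p / ((p - 1) * (Real.log q + Real.log p)) < 1 := by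
  rcases le_or_gt q 128 with h | h
  · exact log_two_div_add_sum_lt_one_of_lt hq hq5 h
  have l0 := Real.log_two_gt_d9
  have l1 := Real.log_two_lt_d9
  have hL := div_mul_log_two_le_log (p := q) (a := 1) (b := 7) one_pos (by
    rw [pow_one]
    omega)
  push_cast at hL
  obtain ⟨n, rfl⟩ : ∃ n, q = n + 1 := ⟨q - 1, by omega⟩
  set L := Real.log (n + 1 : ℕ)
  have hL0 : 0 < L := by linarith
  have h1 := sum_log_div_mul_add_log_le hL0 (n := n) (by omega)
  have hT := sum_log_div_pred_le (N := n) (by omega)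
  have hv := Real.log_natCast_nonneg n
  have hvL : Real.log n ≤ L := Real.log_le_log (by exact_mod_cast (by omega : 0 < n))
    (by push_cast; linarith)
  have h2 : 0 ≤ (Real.log n + 0.79 - ∑ p ∈ (n + 1).primesBelow, Real.log p / (p - 1)) /
      (L + Real.log n) := div_nonneg (by linarith) (by linarith)
  have h3 : Real.log (L + Real.log n) ≤ Real.log 2 + Real.log L := by
    rw [← Real.log_mul (by norm_num) hL0.ne']
    exact Real.log_le_log (by linarith) (by linarith)
  have h4 : Real.log 2 / L + 0.79 / L < 0.306 := by
    rw [← add_div, div_lt_iff₀ hL0]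
    linarith
  linarith

theorem log_one_sub_rpow_le {p : ℕ} (hp : p.Prime) {t : ℝ} (ht : 0 < t) :
    Real.log (1 - (p : ℝ) ^ (-(1 + t))) ≤
      Real.log (1 - 1 / (p : ℝ)) + 1 / (p - 1) + -(1 / ((p : ℝ) - 1)) * (p : ℝ) ^ (-t) := by
  have hp1 : (1 : ℝ) < p := by exact_mod_cast hp.one_lt
  have hp2 : (0 : ℝ) < p - 1 := by linarith
  have hy : (p : ℝ) ^ (-t) < 1 := Real.rpow_lt_one_of_one_lt_of_neg hp1 (by linarith)
  have hinv : 1 / (p : ℝ) < 1 := by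
    rw [div_lt_one (by linarith)]
    exact hp1
  rw [neg_add, Real.rpow_add (by linarith), Real.rpow_neg_one]
  set y := (p : ℝ) ^ (-t)
  have h1 : 0 < 1 + (1 - y) / ((p : ℝ) - 1) := by
    have : 0 ≤ (1 - y) / ((p : ℝ) - 1) := div_nonneg (by linarith) hp2.le
    linarith
  have h2 : 1 - (p : ℝ)⁻¹ * y = (1 - 1 / (p : ℝ)) * (1 + (1 - y) / ((p : ℝ) - 1)) := by
    field_simp
    ring
  rw [h2, Real.log_mul (by linarith) h1.ne']
  have h3 := Real.log_le_sub_one_of_pos h1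
  have h4 : 1 + (1 - y) / ((p : ℝ) - 1) - 1 = 1 / (p - 1) + -(1 / ((p : ℝ) - 1)) * y := by
    ring
  linarith

theorem div_lt_exp_eulerMascheroniConstant_mul_prod {q : ℕ} {L X : ℝ} (hL : 0 < L)
    (hX : X < Real.eulerMascheroniConstant +
      ∑ p ∈ q.primesBelow, Real.log (1 - 1 / (p : ℝ)) + Real.log L + 1) :
    X / L < Real.exp Real.eulerMascheroniConstant *
      ∏ p ∈ q.primesBelow, (1 - 1 / (p : ℝ)) := by
  have hpos : ∀ p ∈ q.primesBelow, 0 < 1 - 1 / (p : ℝ) := by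
    intro p hp
    have := one_lt_cast_of_mem_primesBelow hp
    rw [sub_pos, div_lt_one (by linarith)]
    exact this
  have hP := prod_pos hpos
  set G := Real.exp Real.eulerMascheroniConstant * ∏ p ∈ q.primesBelow, (1 - 1 / (p : ℝ)) with hG
  have hG0 : 0 < G := by positivity
  have h1 := Real.log_le_sub_one_of_pos (mul_pos hG0 hL)
  rw [Real.log_mul hG0.ne' hL.ne', hG, Real.log_mul (Real.exp_ne_zero _) hP.ne', Real.log_exp,
    Real.log_prod fun p hp => (hpos p hp).ne', ← hG] at h1
  rw [div_lt_iff₀ hL]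
  linarith

theorem exists_rough_start_bound_of_five_le {q : ℕ} (hq : q.Prime) (hq5 : 5 ≤ q) :
    ∃ I < Real.exp Real.eulerMascheroniConstant * ∏ p ∈ q.primesBelow, (1 - 1 / (p : ℝ)),
      ∀ F : Finset ℕ, (∀ d ∈ F, 1 < d ∧ ∀ p, p.Prime → p ∣ d → q ≤ p) →
        ∑ d ∈ F, ArithmeticFunction.vonMangoldt d /
          (d * Real.log d * (Real.log q + Real.log d)) ≤ I := by
  have hL : 0 < Real.log q := Real.log_pos (by exact_mod_cast hq.one_lt)
  have hD := log_two_div_add_sum_lt_one hq hq5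
  set L := Real.log q
  set S := ∑ p ∈ q.primesBelow, Real.log (1 - 1 / (p : ℝ)) with hS
  refine ⟨(Real.eulerMascheroniConstant + S + Real.log L + (Real.log 2 / L +
    ∑ p ∈ q.primesBelow, Real.log p / ((p - 1) * (L + Real.log p)))) / L,
    div_lt_exp_eulerMascheroniConstant_mul_prod hL (by linarith), fun F hF => ?_⟩
  have h := sum_rough_vonMangoldt_le_of_forall_rpow (q := q) hL
    (C := S + ∑ p ∈ q.primesBelow, 1 / ((p : ℝ) - 1)) (J := q.primesBelow)
    (fun p hp => (Nat.prime_of_mem_primesBelow hp).one_le)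
    (c := fun p => -(1 / ((p : ℝ) - 1))) (fun t ht => by
      rw [hS, ← sum_add_distrib, ← sum_add_distrib]
      exact sum_le_sum fun p hp => log_one_sub_rpow_le (Nat.prime_of_mem_primesBelow hp) ht) hF
  refine h.trans (le_of_eq ?_)
  have h2 : ∑ p ∈ q.primesBelow, -(1 / ((p : ℝ) - 1)) / (L + Real.log p) =
      (∑ p ∈ q.primesBelow, Real.log p / ((p - 1) * (L + Real.log p)) -
        ∑ p ∈ q.primesBelow, 1 / ((p : ℝ) - 1)) / L := by
    rw [← sum_sub_distrib, sum_div]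
    refine sum_congr rfl fun p hp => ?_
    have := one_lt_cast_of_mem_primesBelow hp
    have h1 : (p : ℝ) - 1 ≠ 0 := by linarith
    have h3 : L + Real.log p ≠ 0 := by
      have := Real.log_natCast_nonneg p
      linarith
    field_simp
    ring
  rw [h2]
  ring

theorem exists_rough_start_bound_three :
    ∃ I < Real.exp Real.eulerMascheroniConstant *
        ∏ p ∈ Nat.primesBelow 3, (1 - 1 / (p : ℝ)),
      ∀ F : Finset ℕ, (∀ d ∈ F, 1 < d ∧ ∀ p, p.Prime → p ∣ d → 3 ≤ p) →
        ∑ d ∈ F, ArithmeticFunction.vonMangoldt d /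
          (d * Real.log d * (Real.log 3 + Real.log d)) ≤ I := by
  have l0 := Real.log_two_gt_d9
  have l1 := Real.log_two_lt_d9
  have t0 := Real.log_three_gt_d9
  have t1 := Real.log_three_lt_d9
  have l4 : Real.log 4 = 2 * Real.log 2 := by
    rw [show (4 : ℝ) = 2 ^ 2 by norm_num, Real.log_pow]
    norm_num
  have hP : Nat.primesBelow 3 = {2} := by decide +kernel
  have hL : 0 < Real.log 3 := by linarith
  set L := Real.log 3
  set l := Real.log 2 with hl
  refine ⟨(Real.eulerMascheroniConstant + Real.log L + l / L + (-l + 0.7) +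
    L * (-0.4 / (L + l) + -0.3 / (L + 2 * l))) / L, ?_, fun F hF => ?_⟩
  · apply div_lt_exp_eulerMascheroniConstant_mul_prod hL
    have h1 : Real.log (1 - 1 / 2) = -l := by
      rw [hl, ← Real.log_inv]
      norm_num
    have h2 : l / L ≤ 0.631 := by
      rw [div_le_iff₀ hL]
      linarith
    have h3 : 0.22 ≤ L * (0.4 / (L + l)) := by
      rw [mul_div_assoc', le_div_iff₀ (by linarith)]
      linarith
    have h4 : 0.12 ≤ L * (0.3 / (L + 2 * l)) := by
      rw [mul_div_assoc', le_div_iff₀ (by linarith)]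
      linarith
    rw [hP, sum_singleton, Nat.cast_ofNat, h1, neg_div, neg_div]
    linarith
  · have h := sum_rough_vonMangoldt_le_of_forall_rpow (q := 3) hL (C := -l + 0.7)
      (J := {2, 4}) (by decide) (c := fun d => if d = 2 then -0.4 else -0.3) (fun t ht => by
        rw [hP, sum_singleton, sum_pair (by norm_num), if_pos rfl, if_neg (by norm_num),
          neg_add, Nat.cast_ofNat, Real.rpow_add (by norm_num), Real.rpow_neg_one]
        have h4 : ((4 : ℕ) : ℝ) ^ (-t) = ((2 : ℝ) ^ (-t)) ^ 2 := by
          rw [← Real.rpow_natCast, ← Real.rpow_mul (by norm_num), mul_comm,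
            Real.rpow_mul (by norm_num)]
          norm_num
        have hy : (2 : ℝ) ^ (-t) < 1 :=
          Real.rpow_lt_one_of_one_lt_of_neg one_lt_two (by linarith)
        have hy0 : 0 < (2 : ℝ) ^ (-t) := by positivity
        rw [h4]
        set y := (2 : ℝ) ^ (-t)
        have h5 : (1 : ℝ) - 2⁻¹ * y = (1 + (1 - y)) / 2 := by ring
        rw [h5, Real.log_div (by linarith) (by norm_num)]
        have h6 := log_one_add_le (z := 1 - y) (by linarith)
        have h7 : (1 - y) * (6 + (1 - y)) / (6 + 4 * (1 - y)) ≤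
            (1 - y) - 0.3 * (1 - y) ^ 2 := by
          rw [div_le_iff₀ (by linarith)]
          nlinarith [mul_nonneg (sq_nonneg (1 - y)) hy0.le]
        nlinarith) hF
    refine h.trans (le_of_eq ?_)
    rw [sum_pair (by norm_num), if_pos rfl, if_neg (by norm_num), Nat.cast_ofNat,
      Nat.cast_ofNat, l4, ← hl]
    have : L + l ≠ 0 := by linarith
    have : L + 2 * l ≠ 0 := by linarith
    field_simp

theorem exists_rough_start_bound_two :
    ∃ I < Real.exp Real.eulerMascheroniConstant *
        ∏ p ∈ Nat.primesBelow 2, (1 - 1 / (p : ℝ)),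
      ∀ F : Finset ℕ, (∀ d ∈ F, 1 < d ∧ ∀ p, p.Prime → p ∣ d → 2 ≤ p) →
        ∑ d ∈ F, ArithmeticFunction.vonMangoldt d /
          (d * Real.log d * (Real.log 2 + Real.log d)) ≤ I := by
  have l0 := Real.log_two_gt_d9
  refine ⟨1 / Real.log 2, ?_, fun F _ => ?_⟩
  · rw [show Nat.primesBelow 2 = ∅ by decide +kernel, prod_empty, mul_one]
    have h1 := Real.one_half_lt_eulerMascheroniConstant
    have h2 := Real.quadratic_le_exp_of_nonneg (x := Real.eulerMascheroniConstant) (by linarith)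
    have h3 : 1 / Real.log 2 ≤ 1.45 := by
      rw [div_le_iff₀ (by linarith)]
      linarith
    nlinarith
  · have h := sum_vonMangoldt_div_log_two_le (le_refl (0 : ℝ)) F
    simp only [zero_add] at h
    refine le_trans (le_of_eq (sum_congr rfl fun d _ => ?_)) h
    rw [div_mul_div_comm, mul_one, mul_assoc]

theorem exists_rough_start_bound {q : ℕ} (hq : q.Prime) :
    ∃ I < Real.exp Real.eulerMascheroniConstant * ∏ p ∈ q.primesBelow, (1 - 1 / (p : ℝ)),
      ∀ F : Finset ℕ, (∀ d ∈ F, 1 < d ∧ ∀ p, p.Prime → p ∣ d → q ≤ p) →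
        ∑ d ∈ F, ArithmeticFunction.vonMangoldt d /
          (d * Real.log d * (Real.log q + Real.log d)) ≤ I := by
  rcases lt_or_ge q 5 with h | h
  · have := hq.two_le
    interval_cases q
    · simpa using exists_rough_start_bound_two
    · simpa using exists_rough_start_bound_three
    · exact absurd hq (by norm_num)
  · exact exists_rough_start_bound_of_five_le hq h

end RoughStart

theorem sum_rough_transition_le {q : ℕ} (hq : q.Prime) {m : ℕ} (hm : 1 < m)
    (hmq : ∀ p, p.Prime → p ∣ m → q ≤ p) {F : Finset ℕ}
    (hF : ∀ d ∈ F, 1 < d ∧ ∀ p, p.Prime → p ∣ d → q ≤ p) :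
    ∑ d ∈ F, 1 / ((m * d : ℕ) * Real.log (q * (m * d) : ℕ)) *
        (ArithmeticFunction.vonMangoldt d / Real.log (m * d : ℕ)) ≤
      1 / (m * Real.log (q * m : ℕ)) := by
  have hle : ∀ d, 1 < d → (∀ p, p.Prime → p ∣ d → q ≤ p) → q ≤ d := fun d hd h =>
    (h _ (Nat.minFac_prime hd.ne') (Nat.minFac_dvd d)).trans (Nat.minFac_le (by omega))
  have hm0 : (0 : ℝ) < m := by exact_mod_cast (by omega : 0 < m)
  have hq0 : (0 : ℝ) < q := by exact_mod_cast hq.pos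
  have hM : Real.log q ≤ Real.log m := Real.log_le_log hq0 (by exact_mod_cast hle m hm hmq)
  have key : ∑ d ∈ F, ArithmeticFunction.vonMangoldt d / d *
      (1 / ((Real.log m + Real.log d) * (Real.log m + Real.log q + Real.log d))) ≤
      1 / (Real.log m + Real.log q) := by
    rcases eq_or_ne q 2 with rfl | hq2
    · exact sum_vonMangoldt_div_log_two_le (Real.log_natCast_nonneg m) F
    · exact sum_vonMangoldt_rough_le hq hq2 hM fun d hd => hle d (hF d hd).1 (hF d hd).2
  have h := mul_le_mul_of_nonneg_left key (show 0 ≤ 1 / (m : ℝ) by positivity)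
  rw [Finset.mul_sum] at h
  refine (le_of_eq (Finset.sum_congr rfl fun d hd => ?_)).trans (h.trans (le_of_eq ?_))
  · have hd0 : (0 : ℝ) < d := by exact_mod_cast (zero_lt_one.trans (hF d hd).1)
    push_cast
    rw [Real.log_mul hq0.ne' (by positivity), Real.log_mul hm0.ne' hd0.ne',
      show Real.log m + Real.log q + Real.log d = Real.log q + (Real.log m + Real.log d) by ring]
    simp only [div_eq_mul_inv, mul_inv]
    ring
  · push_cast
    rw [Real.log_mul hq0.ne' hm0.ne', add_comm (Real.log (m : ℝ)), div_mul_div_comm, one_mul]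

theorem sum_rough_antichain_le {q : ℕ} (hq : q.Prime) {B : Finset ℕ}
    (hB : ∀ a ∈ B, ∀ b ∈ B, a ≠ b → ¬ a ∣ b)
    (hBq : ∀ b ∈ B, 1 < b ∧ ∀ p, p.Prime → p ∣ b → q ≤ p) {I : ℝ}
    (hI : ∀ F : Finset ℕ, (∀ d ∈ F, 1 < d ∧ ∀ p, p.Prime → p ∣ d → q ≤ p) →
      ∑ d ∈ F, ArithmeticFunction.vonMangoldt d /
        (d * Real.log d * (Real.log q + Real.log d)) ≤ I) :
    ∑ b ∈ B, 1 / (b * Real.log (q * b : ℕ)) ≤ I := by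
  refine sum_antichain_le (h := fun m : ℕ => 1 / (m * Real.log (q * m : ℕ))) hB
    (P := fun m => ∀ p, p.Prime → p ∣ m → q ≤ p)
    (fun m d hdm hm p hp hpd => hm p hp (hpd.trans hdm)) hBq
    (fun m => ?_) (fun m hm hmq F hF => sum_rough_transition_le hq hm hmq hF) fun F hF => ?_
  · have := Real.log_natCast_nonneg (q * m)
    positivity
  · refine (le_of_eq (Finset.sum_congr rfl fun d hd => ?_)).trans (hI F hF)
    have hd0 : (0 : ℝ) < d := by exact_mod_cast (zero_lt_one.trans (hF d hd).1)
    have hq0 : (0 : ℝ) < q := by exact_mod_cast hq.pos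
    push_cast
    rw [Real.log_mul hq0.ne' hd0.ne']
    simp only [div_eq_mul_inv, mul_inv]
    ring

theorem f_Aq_lt_exp_gamma_mul_g (A : Set ℕ) (hA : IsPrimitive A)
    (q : ℕ) (hq : q.Prime) (hqA : q ∉ A) :
    f {a ∈ A | a.minFac = q} < Real.exp Real.eulerMascheroniConstant * g q := by
  obtain ⟨I, hIlt, hI⟩ := exists_rough_start_bound hq
  have hq0 : (0 : ℝ) < q := by exact_mod_cast hq.pos
  have hI0 : 0 ≤ I := by simpa using hI ∅ (by simp)
  have hle : f {a ∈ A | a.minFac = q} ≤ 1 / q * I := by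
    refine Real.tsum_le_of_sum_le (fun a => ?_) fun S => ?_
    · have := Real.log_natCast_nonneg a
      positivity
    have hmem : ∀ a : {a ∈ A | a.minFac = q}, (a : ℕ) = q * (a / q) := fun a => by
      have h : (a : ℕ).minFac = q := a.2.2
      exact (Nat.mul_div_cancel' (h.symm.dvd.trans (Nat.minFac_dvd (a : ℕ)))).symm
    have hinj : Set.InjOn (fun a : {a ∈ A | a.minFac = q} => (a : ℕ) / q) S :=
      fun a _ b _ hab => Subtype.ext (by rw [hmem a, hmem b]; exact congrArg (q * ·) hab)
    have h := sum_rough_antichain_le hq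
      (B := S.image fun a : {a ∈ A | a.minFac = q} => (a : ℕ) / q) ?_ ?_ hI
    · rw [Finset.sum_image hinj] at h
      refine le_trans (le_of_eq ?_) (mul_le_mul_of_nonneg_left h
        (show 0 ≤ 1 / (q : ℝ) by positivity))
      rw [Finset.mul_sum]
      refine Finset.sum_congr rfl fun a _ => ?_
      rw [← hmem a, div_mul_div_comm, one_mul, ← mul_assoc, ← Nat.cast_mul, ← hmem a]
    · intro b hb c hc hne hdvd
      obtain ⟨x, -, rfl⟩ := Finset.mem_image.1 hb
      obtain ⟨y, -, rfl⟩ := Finset.mem_image.1 hc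
      refine hA.2 x x.2.1 y y.2.1 (fun h => hne (by rw [h])) ?_
      rw [hmem x, hmem y]
      exact Nat.mul_dvd_mul_left q hdvd
    · intro b hb
      obtain ⟨x, -, rfl⟩ := Finset.mem_image.1 hb
      have hx := hmem x
      have hx1 := hA.1 x x.2.1
      refine ⟨?_, fun p hp hpd => ?_⟩
      · by_contra! h
        interval_cases hk : (x : ℕ) / q
        · omega
        · rw [mul_one] at hx
          exact hqA (hx ▸ x.2.1)
      · have h2 := x.2.2
        rw [← h2]
        exact Nat.minFac_le_of_dvd hp.two_le (hpd.trans (Dvd.intro_left q hx.symm))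
  refine hle.trans_lt ?_
  rw [g, mul_left_comm]
  exact mul_lt_mul_of_pos_left hIlt (by positivity)
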